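/- arXiv:2111.14033 — 17 statements merged into one kernel-verified Lean document; each statement's English description precedes it below -/
import Mathlib

section
/- Let p be a prime, d a natural number with d < p, and ℓ a natural number. For 0 ≤ i ≤ d+1 set α_i = (-1)^{i+1}·C(d+1, i), viewed in ZMod p. Then a function f : ZMod p → (Fin ℓ → ZMod p) satisfies the following property: (each of the ℓ coordinate functions of f is the evaluation function of a univariate polynomial over ZMod p of degree at most d) if and only if for every e ∈ ZMod p one has Σ_{i=0}^{d+1} α_i • f(e + i) = 0, where the index i is cast into ZMod p. -/
/-- A function on `ZMod p` whose `(d + 1)`-st forward difference vanishes is a polynomial function of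
degree at most `d < p`, by Newton's forward difference formula. -/
theorem ZMod.exists_polynomial_of_fwdDiff_iter_eq_zero {p : ℕ} [Fact p.Prime] {d : ℕ} (hd : d < p)
    {g : ZMod p → ZMod p} (hg : (fwdDiff 1)^[d + 1] g = 0) :
    ∃ q : Polynomial (ZMod p), q.natDegree ≤ d ∧ ∀ e, g e = q.eval e := by
  have hvanish (k : ℕ) (hk : d < k) : (fwdDiff 1)^[k] g 0 = 0 := by
    obtain ⟨m, rfl⟩ := Nat.exists_eq_add_of_le' (Nat.succ_le_of_lt hk)
    rw [Function.iterate_add_apply, hg]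
    exact congrFun (Function.iterate_fixed (fwdDiff_const (1 : ZMod p) (0 : ZMod p)) m) 0
  refine ⟨∑ k ∈ Finset.range (d + 1),
    Polynomial.C ((fwdDiff 1)^[k] g 0 * (k.factorial : ZMod p)⁻¹) * descPochhammer (ZMod p) k,
    Polynomial.natDegree_sum_le_of_forall_le _ _ fun k hk ↦ ?_, fun e ↦ ?_⟩
  · refine (Polynomial.natDegree_C_mul_le _ _).trans ?_
    rw [descPochhammer_natDegree]
    exact Nat.le_of_lt_succ (Finset.mem_range.mp hk)
  · obtain ⟨n, rfl⟩ := ZMod.natCast_zmod_surjective e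
    have hshift := shift_eq_sum_fwdDiff_iter (1 : ZMod p) g n 0
    rw [zero_add, nsmul_one] at hshift
    have hterm (k : ℕ) (hk : k ∈ Finset.range (d + 1)) :
        (Polynomial.C ((fwdDiff 1)^[k] g 0 * (k.factorial : ZMod p)⁻¹) *
          descPochhammer (ZMod p) k).eval (n : ZMod p) = n.choose k • (fwdDiff 1)^[k] g 0 := by
      have hkp : k < p := (Nat.le_of_lt_succ (Finset.mem_range.mp hk)).trans_lt hd
      have hfac : (k.factorial : ZMod p) ≠ 0 := by
        rw [Ne, ZMod.natCast_eq_zero_iff, (Fact.out : p.Prime).dvd_factorial]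
        exact hkp.not_ge
      rw [Polynomial.eval_mul, Polynomial.eval_C, descPochhammer_eval_eq_descFactorial,
        Nat.descFactorial_eq_factorial_mul_choose, nsmul_eq_mul, Nat.cast_mul]
      field_simp
    rw [hshift, Polynomial.eval_finsetSum, Finset.sum_congr rfl hterm]
    rcases le_total n d with hnd | hdn
    · refine Finset.sum_subset (Finset.range_subset_range.mpr (by lia)) fun k _ hk ↦ ?_
      rw [Nat.choose_eq_zero_of_lt (by simpa using hk), zero_smul]
    · refine (Finset.sum_subset (Finset.range_subset_range.mpr (by lia)) fun k _ hk ↦ ?_).symm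
      rw [hvanish k (by simpa using hk), smul_zero]

/-- The alternating binomial sum in terms of the iterated forward difference. -/
theorem sum_neg_one_pow_succ_mul_choose_mul_eq_fwdDiff_iter {R : Type*} [CommRing R] (g : R → R)
    (n : ℕ) (e : R) :
    ∑ i ∈ Finset.range (n + 1), ((-1 : R) ^ (i + 1) * (n.choose i : R)) * g (e + (i : R)) =
      (-1) ^ (n + 1) * (fwdDiff 1)^[n] g e := by
  rw [fwdDiff_iter_eq_sum_shift, Finset.mul_sum]
  refine Finset.sum_congr rfl fun i hi ↦ ?_
  obtain ⟨m, rfl⟩ := Nat.exists_eq_add_of_le (Nat.le_of_lt_succ (Finset.mem_range.mp hi))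
  have hsign : (-1 : R) ^ m * (-1) ^ m = 1 := by rw [← mul_pow]; simp
  rw [Nat.add_sub_cancel_left, nsmul_one, zsmul_eq_mul]
  push_cast
  linear_combination (-(-1 : R) ^ (i + 1) * ((i + m).choose i : R) * g (e + i)) * hsign

theorem stmt_0 (p : ℕ) [Fact p.Prime] (d ℓ : ℕ) (hd : d < p)
    (f : ZMod p → (Fin ℓ → ZMod p)) :
    (∀ j : Fin ℓ, ∃ q : Polynomial (ZMod p), q.natDegree ≤ d ∧
        ∀ e : ZMod p, f e j = q.eval e) ↔
    (∀ e : ZMod p, ∑ i ∈ Finset.range (d + 2),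
        ((-1 : ZMod p) ^ (i + 1) * ((d + 1).choose i : ZMod p)) • f (e + (i : ZMod p)) = 0) := by
  have hcoord (e : ZMod p) (j : Fin ℓ) :
      (∑ i ∈ Finset.range (d + 2),
        ((-1 : ZMod p) ^ (i + 1) * ((d + 1).choose i : ZMod p)) • f (e + (i : ZMod p))) j =
      (-1) ^ (d + 1 + 1) * (fwdDiff 1)^[d + 1] (fun x ↦ f x j) e := by
    rw [← sum_neg_one_pow_succ_mul_choose_mul_eq_fwdDiff_iter, Finset.sum_apply]
    rfl
  constructor
  · intro h e
    ext j
    obtain ⟨q, hq, hf⟩ := h j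
    rw [hcoord, funext hf,
      Polynomial.fwdDiff_iter_eq_zero_of_degree_lt (Nat.lt_succ_of_le hq)]
    simp
  · intro h j
    refine ZMod.exists_polynomial_of_fwdDiff_iter_eq_zero hd (funext fun e ↦ ?_)
    have he := hcoord e j
    rw [h e] at he
    simpa using he.symm
end

section
/- Let p be a prime and d, m, ℓ natural numbers with p > 2d. Let f : (Fin m → ZMod p) → (Fin ℓ → ZMod p). Suppose that for every x, h ∈ (Fin m → ZMod p) there exist univariate polynomials q_1, …, q_ℓ over ZMod p, each of degree at most d, such that for every i ∈ ZMod p and every j ∈ Fin ℓ, f(x + i • h) j = q_j(i). Then f is degree-d, i.e., for every j ∈ Fin ℓ there exists a multivariate polynomial P_j over ZMod p in m variables with total degree at most d such that f(x) j = P_j(x) for all x. -/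
namespace MvPolynomial

theorem IsHomogeneous.eval_smul_point {σ R : Type*} [CommSemiring R] {φ : MvPolynomial σ R}
    {n : ℕ} (hφ : φ.IsHomogeneous n) (t : R) (h : σ → R) :
    eval (t • h) φ = t ^ n * eval h φ := by
  rw [eval_eq, eval_eq, Finset.mul_sum]
  refine Finset.sum_congr rfl fun a ha => ?_
  have hdeg : ∑ i ∈ a.support, a i = n := by
    rw [← hφ (mem_support_iff.mp ha), Finsupp.weight_apply]
    simp [Finsupp.sum]
  simp only [Pi.smul_apply, smul_eq_mul, mul_pow, Finset.prod_mul_distrib,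
    Finset.prod_pow_eq_pow_sum, hdeg]
  ring

/-- The restriction of a multivariate polynomial to the line through the origin in direction `h`,
as a univariate polynomial whose coefficients are the values of the homogeneous components. -/
theorem exists_polynomial_eval_smul {σ R : Type*} [CommSemiring R] (P : MvPolynomial σ R)
    (h : σ → R) : ∃ Q : Polynomial R, Q.natDegree ≤ P.totalDegree ∧
      (∀ t, eval (t • h) P = Q.eval t) ∧ ∀ n, Q.coeff n = eval h (homogeneousComponent n P) := by
  refine ⟨∑ n ∈ Finset.range (P.totalDegree + 1),
    Polynomial.monomial n (eval h (homogeneousComponent n P)), ?_, fun t => ?_, fun n => ?_⟩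
  · refine Polynomial.natDegree_sum_le_of_forall_le _ _ fun n hn => ?_
    exact (Polynomial.natDegree_monomial_le _).trans (Nat.lt_succ_iff.mp (Finset.mem_range.mp hn))
  · conv_lhs => rw [← sum_homogeneousComponent P]
    rw [map_sum, Polynomial.eval_finsetSum]
    refine Finset.sum_congr rfl fun n _ => ?_
    rw [(homogeneousComponent_isHomogeneous n P).eval_smul_point, Polynomial.eval_monomial,
      mul_comm]
  · simp only [Polynomial.finsetSum_coeff, Polynomial.coeff_monomial, Finset.sum_ite_eq',
      Finset.mem_range]
    split_ifs with hn
    · rfl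
    · rw [homogeneousComponent_eq_zero _ _ (by omega), map_zero]

/-- A polynomial of degree less than the size of the field whose restriction to every line
through the origin has degree at most `d` has total degree at most `d`. -/
theorem totalDegree_le_of_eval_smul_eq {σ F : Type*} [Field F] [Fintype F] {d : ℕ}
    (P : MvPolynomial σ F) (hd : d < Fintype.card F) (hP : P.totalDegree < Fintype.card F)
    (hline : ∀ h : σ → F, ∃ q : Polynomial F, q.natDegree ≤ d ∧
      ∀ t, eval (t • h) P = q.eval t) :
    P.totalDegree ≤ d := by
  have hzero : ∀ n, d < n → homogeneousComponent n P = 0 := by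
    intro n hn
    by_cases hnP : P.totalDegree < n
    · exact homogeneousComponent_eq_zero _ _ hnP
    refine (homogeneousComponent_isHomogeneous n P).eq_zero_of_forall_eval_eq_zero_of_le_card
      (fun h => ?_) ?_
    · obtain ⟨Q, hQdeg, hQ, hQcoeff⟩ := exists_polynomial_eval_smul P h
      obtain ⟨q, hqdeg, hq⟩ := hline h
      have hQq : Q = q := by
        refine Polynomial.eq_of_degrees_lt_of_eval_finset_eq Finset.univ ?_ ?_
          fun t _ => (hQ t).symm.trans (hq t)
        · exact Polynomial.degree_le_natDegree.trans_lt
            (Nat.cast_lt.mpr (hQdeg.trans_lt hP))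
        · exact Polynomial.degree_le_natDegree.trans_lt
            (Nat.cast_lt.mpr (hqdeg.trans_lt hd))
      rw [← hQcoeff, hQq]
      exact Polynomial.coeff_eq_zero_of_natDegree_lt (by omega)
    · rw [Cardinal.mk_fintype]
      exact_mod_cast (by omega : n ≤ Fintype.card F)
  rw [← sum_homogeneousComponent P]
  refine totalDegree_finsetSum_le fun n _ => ?_
  by_cases hn : d < n
  · simp [hzero n hn]
  · exact (homogeneousComponent_isHomogeneous n P).totalDegree_le.trans (not_lt.mp hn)

theorem totalDegree_toMvPolynomial_le {σ R : Type*} [CommSemiring R] (i : σ)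
    (q : Polynomial R) : (q.toMvPolynomial i).totalDegree ≤ q.natDegree := by
  rw [Polynomial.toMvPolynomial, Polynomial.aeval_eq_sum_range]
  refine totalDegree_finsetSum_le fun n hn => ?_
  refine (totalDegree_smul_le _ _).trans ?_
  cases subsingleton_or_nontrivial R
  · rw [Subsingleton.elim (X i ^ n : MvPolynomial σ R) 0]
    simp
  · rw [totalDegree_X_pow]
    exact Nat.lt_succ_iff.mp (Finset.mem_range.mp hn)

/-- A function on `F ^ m` whose restriction to every line has degree at most `d`, where
`2 * d < #F`, is a polynomial of total degree at most `d`. -/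
theorem exists_totalDegree_le_of_forall_line {F : Type*} [Field F] [Fintype F] {d : ℕ}
    (hd : 2 * d < Fintype.card F) {m : ℕ} (f : (Fin m → F) → F)
    (hline : ∀ x h : Fin m → F, ∃ q : Polynomial F, q.natDegree ≤ d ∧
      ∀ t : F, f (x + t • h) = q.eval t) :
    ∃ P : MvPolynomial (Fin m) F, P.totalDegree ≤ d ∧ ∀ x, f x = eval x P := by
  classical
  induction m with
  | zero =>
    refine ⟨C (f 0), by simp, fun x => ?_⟩
    rw [eval_C, Subsingleton.elim x 0]
  | succ m ih =>
    have hslice : ∀ c : F, ∃ P : MvPolynomial (Fin m) F, P.totalDegree ≤ d ∧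
        ∀ x, f (Fin.cons c x) = eval x P := by
      intro c
      refine ih (fun x => f (Fin.cons c x)) fun x h => ?_
      obtain ⟨q, hqdeg, hq⟩ := hline (Fin.cons c x) (Fin.cons 0 h)
      refine ⟨q, hqdeg, fun t => ?_⟩
      rw [← hq]
      congr 1
      ext k
      refine Fin.cases ?_ (fun k => ?_) k <;> simp
    choose P hPdeg hP using hslice
    obtain ⟨S, -, hS⟩ := Finset.exists_subset_card_eq
      (s := (Finset.univ : Finset F)) (n := d + 1) (by rw [Finset.card_univ]; omega)
    have hinj : Set.InjOn (id : F → F) S := Function.injective_id.injOn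
    let G : MvPolynomial (Fin (m + 1)) F := ∑ c ∈ S,
      rename Fin.succ (P c) * (Lagrange.basis S id c).toMvPolynomial 0
    have hG : ∀ x, f x = eval x G := by
      intro x
      obtain ⟨q, hqdeg, hq⟩ := hline (Fin.cons 0 (Fin.tail x)) (Fin.cons 1 0)
      have hq' : ∀ t : F, f (Fin.cons t (Fin.tail x)) = q.eval t := by
        intro t
        rw [← hq]
        congr 1
        ext k
        refine Fin.cases ?_ (fun k => ?_) k <;> simp
      have hinterp := Lagrange.eq_interpolate (f := q) hinj (by
        rw [hS]
        exact Polynomial.degree_le_natDegree.trans_lt (Nat.cast_lt.mpr (by omega)))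
      calc f x = q.eval (x 0) := by rw [← hq', Fin.cons_self_tail]
        _ = eval x G := by
          rw [hinterp, Lagrange.interpolate_apply, Polynomial.eval_finsetSum, map_sum]
          refine Finset.sum_congr rfl fun c _ => ?_
          rw [Polynomial.eval_mul, Polynomial.eval_C, map_mul, eval_toMvPolynomial, eval_rename,
            id, ← hq', hP]
          rfl
    have hGdeg : G.totalDegree ≤ d + d := by
      refine totalDegree_finsetSum_le fun c hc => (totalDegree_mul _ _).trans (add_le_add ?_ ?_)
      · exact (totalDegree_rename_le _ _).trans (hPdeg c)
      · refine (totalDegree_toMvPolynomial_le _ _).trans ?_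
        rw [Lagrange.natDegree_basis hinj hc, hS, Nat.add_sub_cancel]
    refine ⟨G, totalDegree_le_of_eval_smul_eq G (by omega) (by omega) fun h => ?_, hG⟩
    obtain ⟨q, hqdeg, hq⟩ := hline 0 h
    exact ⟨q, hqdeg, fun t => by rw [← hG, ← hq, zero_add]⟩

end MvPolynomial

theorem stmt_1 (p : ℕ) [Fact p.Prime] (d m ℓ : ℕ) (hp : 2 * d < p)
    (f : (Fin m → ZMod p) → (Fin ℓ → ZMod p))
    (hline : ∀ x h : Fin m → ZMod p, ∃ q : Fin ℓ → Polynomial (ZMod p),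
      (∀ j : Fin ℓ, (q j).natDegree ≤ d) ∧
      ∀ i : ZMod p, ∀ j : Fin ℓ, f (x + i • h) j = (q j).eval i) :
    ∀ j : Fin ℓ, ∃ P : MvPolynomial (Fin m) (ZMod p), P.totalDegree ≤ d ∧
      ∀ x : Fin m → ZMod p, f x j = MvPolynomial.eval x P := by
  intro j
  refine MvPolynomial.exists_totalDegree_le_of_forall_line (by rwa [ZMod.card])
    (fun x => f x j) fun x h => ?_
  obtain ⟨q, hqdeg, hq⟩ := hline x h
  exact ⟨q j, hqdeg j, fun t => hq t j⟩
end

section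
/- Let p be a prime and d, m, ℓ natural numbers with p > 2d. For 0 ≤ i ≤ d+1 set α_i = (-1)^{i+1}·C(d+1, i) ∈ ZMod p. A function f : (Fin m → ZMod p) → (Fin ℓ → ZMod p) is degree-d if and only if for every x, h ∈ (Fin m → ZMod p) one has Σ_{i=0}^{d+1} α_i • f(x + i • h) = 0, where the index i is cast into ZMod p. -/
open Finset fwdDiff

/-- Djoković's polarization: an ideal containing the `n`-th powers of all `T h - 1` contains every
product of `n` elements of this form, provided that `1, …, n` are invertible scalars. -/
theorem AddChar.prod_sub_one_mem_of_pow_mem {K V R : Type*} [Field K] [AddCommGroup V]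
    [Module K V] [CommRing R] (T : AddChar V R) {n : ℕ}
    (hn : ∀ i : ℕ, 0 < i → i ≤ n → (i : K) ≠ 0) {I : Ideal R}
    (hI : ∀ h : V, (T h - 1) ^ n ∈ I) (h : Fin n → V) : ∏ j, (T (h j) - 1) ∈ I := by
  let c : Fin n → V := fun j ↦ ((j + 1 : ℕ) : K)⁻¹ • h j
  have hmem : ∑ t ∈ (univ : Finset (Fin n)).powerset,
      (∏ j ∈ t, -T (h j)) * (T (-∑ j ∈ t, c j) - 1) ^ n ∈ I :=
    I.sum_mem fun t _ ↦ I.mul_mem_left _ (hI _)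
  have hprod (i : ℕ) (t : Finset (Fin n)) :
      (∏ j ∈ t, -T (h j)) * T (-∑ j ∈ t, c j) ^ i = ∏ j ∈ t, -T (h j - i • c j) := by
    have hsum : T (-∑ j ∈ t, c j) = ∏ j ∈ t, T (-c j) := by
      rw [← sum_neg_distrib]
      exact map_prod T.toMonoidHom (fun j ↦ Multiplicative.ofAdd (-c j)) t
    rw [hsum, ← prod_pow, ← prod_mul_distrib]
    refine prod_congr rfl fun j _ ↦ ?_
    rw [← AddChar.map_nsmul_eq_pow, neg_mul, ← AddChar.map_add_eq_mul, smul_neg, sub_eq_add_neg]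
  have hzero (i : ℕ) (hi : i ∈ range n) : ∏ j, (1 - T (h j - (i + 1) • c j)) = 0 := by
    rw [mem_range] at hi
    refine prod_eq_zero (mem_univ ⟨i, hi⟩) ?_
    have hc : (i + 1) • c ⟨i, hi⟩ = h ⟨i, hi⟩ := by
      rw [← Nat.cast_smul_eq_nsmul K, smul_inv_smul₀ (hn _ i.succ_pos hi)]
    rw [hc, sub_self, AddChar.map_zero_eq_one, sub_self]
  have hsum : ∑ t ∈ (univ : Finset (Fin n)).powerset,
      (∏ j ∈ t, -T (h j)) * (T (-∑ j ∈ t, c j) - 1) ^ n = ∏ j, (T (h j) - 1) := by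
    calc _ = ∑ i ∈ range (n + 1), (-1) ^ (n - i) * (n.choose i : R) *
          ∏ j, (1 - T (h j - i • c j)) := by
          simp_rw [sub_eq_add_neg (T _) 1, add_pow, mul_sum]
          rw [sum_comm]
          refine sum_congr rfl fun i _ ↦ ?_
          simp_rw [sub_eq_add_neg (1 : R), prod_one_add, mul_sum, ← hprod]
          exact sum_congr rfl fun t _ ↦ by ring
      _ = ∏ j, (T (h j) - 1) := by
          rw [sum_range_succ', sum_eq_zero fun i hi ↦ by rw [hzero i hi, mul_zero], zero_add]
          have hneg : ∏ j, (T (h j) - 1) = ∏ j, (-1) * (1 - T (h j)) :=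
            prod_congr rfl fun j _ ↦ by ring
          rw [hneg, prod_mul_distrib]
          simp
  exact hsum ▸ hmem

/-- Translation of functions, as an action of the group algebra. -/
noncomputable def shiftAlgHom (V G : Type*) [AddCommGroup V] [AddCommGroup G] :
    AddMonoidAlgebra ℤ V →ₐ[ℤ] Module.End ℤ (V → G) :=
  AddMonoidAlgebra.lift ℤ _ V
    { toFun h := fwdDiff_aux.shiftₗ V G h.toAdd
      map_one' := by ext; simp [fwdDiff_aux.shiftₗ_apply]
      map_mul' a b := by
        ext f x
        simp [fwdDiff_aux.shiftₗ_apply, add_assoc] }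

theorem shiftAlgHom_of_sub_one {V G : Type*} [AddCommGroup V] [AddCommGroup G] (h : V) :
    shiftAlgHom V G (AddMonoidAlgebra.of ℤ V (.ofAdd h) - 1) = fwdDiff_aux.fwdDiffₗ V G h := by
  simp [shiftAlgHom, fwdDiff_aux.shiftₗ]

theorem foldr_fwdDiff_eq_shiftAlgHom {V G : Type*} [AddCommGroup V] [AddCommGroup G] (f : V → G)
    (l : List V) : l.foldr fwdDiff f =
      shiftAlgHom V G (l.map fun h ↦ AddMonoidAlgebra.of ℤ V (.ofAdd h) - 1).prod f := by
  induction l with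
  | nil => simp
  | cons h l ih =>
    rw [List.map_cons, List.prod_cons, map_mul, shiftAlgHom_of_sub_one, Module.End.mul_apply,
      ← ih, fwdDiff_aux.coe_fwdDiffₗ, List.foldr_cons]

/-- If all `n`-fold differences with a repeated step vanish, then so do all mixed ones. -/
theorem foldr_fwdDiff_eq_zero_of_iterate {K V G : Type*} [Field K] [AddCommGroup V] [Module K V]
    [AddCommGroup G] {n : ℕ} (hn : ∀ i : ℕ, 0 < i → i ≤ n → (i : K) ≠ 0) {f : V → G}
    (hf : ∀ h : V, (Δ_[h])^[n] f = 0) (l : List V) (hl : l.length = n) :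
    l.foldr fwdDiff f = 0 := by
  let T : AddChar V (AddMonoidAlgebra ℤ V) := AddChar.toMonoidHomEquiv.symm (AddMonoidAlgebra.of ℤ V)
  let I : Ideal (AddMonoidAlgebra ℤ V) := Ideal.span (Set.range fun h ↦ (T h - 1) ^ n)
  have hI (a : AddMonoidAlgebra ℤ V) (ha : a ∈ I) : shiftAlgHom V G a f = 0 := by
    induction ha using Submodule.span_induction with
    | mem a ha =>
      obtain ⟨h, rfl⟩ := ha
      change shiftAlgHom V G ((AddMonoidAlgebra.of ℤ V (.ofAdd h) - 1) ^ n) f = 0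
      rw [map_pow, shiftAlgHom_of_sub_one, fwdDiff_aux.coe_fwdDiffₗ_pow, hf]
    | zero => simp
    | add a b _ _ ha hb => simp [ha, hb]
    | smul a b _ hb => rw [smul_eq_mul, map_mul, Module.End.mul_apply, hb, map_zero]
  subst hl
  have hprod := T.prod_sub_one_mem_of_pow_mem hn (I := I)
    (fun h ↦ Ideal.subset_span ⟨h, rfl⟩) l.get
  rw [foldr_fwdDiff_eq_shiftAlgHom]
  apply hI
  convert hprod
  rw [← List.prod_ofFn]
  conv_lhs => rw [← List.ofFn_get l, List.map_ofFn]
  rfl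

/-- A function on `(ZMod p)^σ` all of whose mixed differences of order `d + 1` vanish is, on every
coordinate subspace, a polynomial of degree at most `d`. -/
theorem exists_mvPolynomial_of_foldr_fwdDiff {p : ℕ} [Fact p.Prime] {σ : Type*} [DecidableEq σ]
    (s : Finset σ) (d : ℕ) (hd : d < p) (f : (σ → ZMod p) → ZMod p)
    (hf : ∀ l : List (σ → ZMod p), l.length = d + 1 → l.foldr fwdDiff f = 0) :
    ∃ P : MvPolynomial σ (ZMod p), P.totalDegree ≤ d ∧
      ∀ x, f (s.piecewise x 0) = MvPolynomial.eval x P := by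
  induction s using Finset.induction_on generalizing d f with
  | empty => exact ⟨MvPolynomial.C (f 0), by simp, by simp⟩
  | insert i s hi ih =>
    let e : σ → ZMod p := Pi.single i 1
    have hfold (k : ℕ) (l : List (σ → ZMod p)) :
        l.foldr fwdDiff ((Δ_[e])^[k] f) = (l ++ List.replicate k e).foldr fwdDiff f := by
      rw [List.foldr_append]
      congr 1
      induction k with
      | zero => rfl
      | succ k ihk => rw [Function.iterate_succ_apply', ihk, List.replicate_succ, List.foldr_cons]
    have hvanish (k : ℕ) (hk : d < k) : (Δ_[e])^[k] f = 0 := by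
      obtain ⟨j, rfl⟩ := Nat.exists_eq_add_of_le' (Nat.succ_le_of_lt hk)
      rw [Function.iterate_add_apply]
      have h0 : (Δ_[e])^[d + 1] f = 0 := by
        simpa using (hfold (d + 1) []).trans (hf _ (by simp))
      rw [h0, ← fwdDiff_aux.coe_fwdDiffₗ_pow, map_zero]
    have hex (k : ℕ) : ∃ P : MvPolynomial σ (ZMod p), k ≤ d → P.totalDegree ≤ d - k ∧
        ∀ x, (Δ_[e])^[k] f (s.piecewise x 0) = MvPolynomial.eval x P := by
      by_cases hk : k ≤ d
      · obtain ⟨P, hP⟩ := ih (d - k) (by lia) ((Δ_[e])^[k] f) fun l hl ↦ by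
          rw [hfold]
          exact hf _ (by simp; lia)
        exact ⟨P, fun _ ↦ hP⟩
      · exact ⟨0, fun h ↦ absurd h hk⟩
    choose P hP using hex
    let B (k : ℕ) : MvPolynomial σ (ZMod p) :=
      MvPolynomial.C (k.factorial : ZMod p)⁻¹ *
        Polynomial.aeval (MvPolynomial.X i) (descPochhammer (ZMod p) k)
    have hBdeg (k : ℕ) : (B k).totalDegree ≤ k := by
      refine (MvPolynomial.totalDegree_mul _ _).trans ?_
      rw [MvPolynomial.totalDegree_C, zero_add, Polynomial.aeval_eq_sum_range]
      refine MvPolynomial.totalDegree_finsetSum_le fun j hj ↦ ?_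
      rw [descPochhammer_natDegree, mem_range] at hj
      refine (MvPolynomial.totalDegree_smul_le _ _).trans ?_
      rw [MvPolynomial.totalDegree_X_pow]
      lia
    have hBeval (k : ℕ) (hk : k ≤ d) (x : σ → ZMod p) :
        MvPolynomial.eval x (B k) = ((x i).val.choose k : ZMod p) := by
      have hfac : (k.factorial : ZMod p) ≠ 0 := by
        rw [Ne, ZMod.natCast_eq_zero_iff, (Fact.out : p.Prime).dvd_factorial]
        lia
      have heval : MvPolynomial.eval x (Polynomial.aeval (MvPolynomial.X i)
          (descPochhammer (ZMod p) k)) = (descPochhammer (ZMod p) k).eval (x i) := by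
        rw [← MvPolynomial.coe_aeval_eq_eval, RingHom.coe_coe, ← Polynomial.aeval_algHom_apply]
        simp
      rw [map_mul, MvPolynomial.eval_C, heval, inv_mul_eq_iff_eq_mul₀ hfac]
      conv_lhs => rw [← ZMod.natCast_zmod_val (x i)]
      rw [descPochhammer_eval_eq_descFactorial, Nat.descFactorial_eq_factorial_mul_choose,
        Nat.cast_mul]
    refine ⟨∑ k ∈ range (d + 1), B k * P k, ?_, fun x ↦ ?_⟩
    · refine MvPolynomial.totalDegree_finsetSum_le fun k hk ↦ ?_
      have hk : k ≤ d := by simpa [Nat.lt_succ_iff] using hk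
      have hPk := (hP k hk).1
      have hBk := hBdeg k
      exact (MvPolynomial.totalDegree_mul _ _).trans (by lia)
    · have hx : (insert i s).piecewise x 0 = s.piecewise x 0 + (x i).val • e := by
        ext j
        by_cases hj : j = i
        · subst hj
          rw [Pi.add_apply, Pi.smul_apply]
          simp [e, hi]
        · simp [e, hj, Finset.piecewise]
      rw [hx, shift_eq_sum_fwdDiff_iter e f, map_sum]
      have hterm (k : ℕ) (hk : d < k) :
          (x i).val.choose k • (Δ_[e])^[k] f (s.piecewise x 0) = 0 := by
        rw [hvanish k hk, Pi.zero_apply, smul_zero]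
      calc _ = ∑ k ∈ range (max d (x i).val + 1),
            (x i).val.choose k • (Δ_[e])^[k] f (s.piecewise x 0) := by
            refine sum_subset (range_mono (by lia)) fun k _ hk ↦ ?_
            rw [Nat.choose_eq_zero_of_lt (by simpa using hk), zero_smul]
        _ = ∑ k ∈ range (d + 1), (x i).val.choose k • (Δ_[e])^[k] f (s.piecewise x 0) :=
            (sum_subset (range_mono (by lia)) fun k _ hk ↦ hterm k (by simpa using hk)).symm
        _ = _ := by
            refine sum_congr rfl fun k hk ↦ ?_
            have hk : k ≤ d := by simpa [Nat.lt_succ_iff] using hk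
            rw [map_mul, hBeval k hk, (hP k hk).2, nsmul_eq_mul]

theorem MvPolynomial.fwdDiff_iter_eval_eq_zero {R σ : Type*} [CommRing R]
    (P : MvPolynomial σ R) {n : ℕ} (hP : P.totalDegree < n) (h : σ → R) :
    (Δ_[h])^[n] (fun x ↦ MvPolynomial.eval x P) = 0 := by
  funext x
  let Q : Polynomial R :=
    MvPolynomial.aeval (fun i ↦ Polynomial.C (h i) * Polynomial.X + Polynomial.C (x i)) P
  have hQ : Q.natDegree < n :=
    (MvPolynomial.aeval_natDegree_le P le_rfl _
      fun _ ↦ Polynomial.natDegree_linear_le).trans_lt (by simpa using hP)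
  have heval (k : ℕ) : MvPolynomial.eval (x + k • h) P = Q.eval (0 + k • (1 : R)) := by
    rw [← Polynomial.coe_aeval_eq_eval, ← MvPolynomial.coe_aeval_eq_eval, RingHom.coe_coe,
      ← AlgHom.comp_apply, MvPolynomial.comp_aeval]
    congr 2
    ext i
    simp
    ring
  have hzero := congr_fun (Polynomial.fwdDiff_iter_eq_zero_of_degree_lt hQ) 0
  rw [fwdDiff_iter_eq_sum_shift] at hzero ⊢
  simp only [heval]
  exact hzero

theorem sum_alternating_choose_smul_eq_fwdDiff {K V G : Type*} [CommRing K] [AddCommGroup V]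
    [Module K V] [AddCommGroup G] [Module K G] (f : V → G) (d : ℕ) (x h : V) :
    ∑ i ∈ Finset.range (d + 2),
      ((-1 : K) ^ (i + 1) * ((d + 1).choose i : K)) • f (x + (i : K) • h) =
      (-1 : K) ^ d • (Δ_[h])^[d + 1] f x := by
  rw [fwdDiff_iter_eq_sum_shift, smul_sum]
  refine sum_congr rfl fun i hi ↦ ?_
  obtain ⟨k, hk⟩ := Nat.exists_eq_add_of_le (Nat.lt_succ_iff.mp (mem_range.mp hi))
  have hsign : (-1 : K) ^ (i + 1) = (-1) ^ d * (-1) ^ k := by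
    rw [← pow_add]
    refine neg_one_pow_congr ?_
    grind
  have hk' : d + 1 - i = k := by lia
  rw [Nat.cast_smul_eq_nsmul, hk', ← Int.cast_smul_eq_zsmul K, smul_smul, hsign]
  push_cast
  rw [mul_assoc]

theorem stmt_2 (p : ℕ) [Fact p.Prime] (d m ℓ : ℕ) (hp : 2 * d < p)
    (f : (Fin m → ZMod p) → (Fin ℓ → ZMod p)) :
    (∀ j : Fin ℓ, ∃ P : MvPolynomial (Fin m) (ZMod p), P.totalDegree ≤ d ∧
        ∀ x : Fin m → ZMod p, f x j = MvPolynomial.eval x P) ↔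
    (∀ x h : Fin m → ZMod p, ∑ i ∈ Finset.range (d + 2),
        ((-1 : ZMod p) ^ (i + 1) * ((d + 1).choose i : ZMod p)) • f (x + (i : ZMod p) • h) = 0) := by
  have hcoord (x h : Fin m → ZMod p) (j : Fin ℓ) : (∑ i ∈ Finset.range (d + 2),
      ((-1 : ZMod p) ^ (i + 1) * ((d + 1).choose i : ZMod p)) • f (x + (i : ZMod p) • h)) j =
      (-1 : ZMod p) ^ d • (Δ_[h])^[d + 1] (fun y ↦ f y j) x := by
    rw [← sum_alternating_choose_smul_eq_fwdDiff, Finset.sum_apply]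
    rfl
  have hdp : d + 1 < p := by
    have := (Fact.out : p.Prime).two_le
    lia
  constructor
  · intro hf x h
    ext j
    obtain ⟨P, hP, hfP⟩ := hf j
    rw [hcoord, funext hfP, P.fwdDiff_iter_eval_eq_zero (Nat.lt_succ_of_le hP)]
    simp
  · intro hf j
    have hiter (h : Fin m → ZMod p) : (Δ_[h])^[d + 1] (fun y ↦ f y j) = 0 := by
      funext x
      have hx := hcoord x h j
      rw [hf x h] at hx
      exact (smul_eq_zero.mp hx.symm).resolve_left (pow_ne_zero _ (neg_ne_zero.mpr one_ne_zero))
    have hn (i : ℕ) (hi : 0 < i) (hid : i ≤ d + 1) : (i : ZMod p) ≠ 0 := by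
      rw [Ne, ZMod.natCast_eq_zero_iff]
      exact Nat.not_dvd_of_pos_of_lt hi (by lia)
    simpa using exists_mvPolynomial_of_foldr_fwdDiff univ d (by lia) (fun y ↦ f y j)
      (foldr_fwdDiff_eq_zero_of_iterate hn hiter)
end

section
/- Let p be a prime and d, m, ℓ natural numbers with p > 2d, and let δ > 0 be a real number. For 0 ≤ i ≤ d+1 set α_i = (-1)^{i+1}·C(d+1, i) ∈ ZMod p. Let f : (Fin m → ZMod p) → (Fin ℓ → ZMod p) and suppose f is not δ-close to degree-d functions, i.e., for every degree-d function g : (Fin m → ZMod p) → (Fin ℓ → ZMod p), the number of points x with f(x) ≠ g(x) is greater than δ·p^m. Then the number of pairs (x, h) ∈ (Fin m → ZMod p)² with Σ_{i=0}^{d+1} α_i • f(x + i • h) ≠ 0 is at least (min(δ, 1/(d+2)²)/2)·p^{2m}. -/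
open Finset

section Counting

theorem card_filter_exists_le {ι α : Type*} [Fintype α] {s : Finset ι} {P : ι → α → Prop}
    [∀ i, DecidablePred (P i)] {_ : DecidablePred fun a => ∃ i ∈ s, P i a} {n : ℕ}
    (h : ∀ i ∈ s, #{a | P i a} ≤ n) : #{a | ∃ i ∈ s, P i a} ≤ #s * n := by
  classical
  refine (card_le_card fun a ha => ?_).trans (card_biUnion_le_card_mul s _ n h)
  simpa using ha

variable {K V W : Type*} [Field K] [AddCommGroup V] [Module K V] [Fintype V]
  [AddCommGroup W] [Module K W] [DecidableEq W]

/-- The prediction for `f x` from the values of `f` at `x + h, …, x + (d + 1) • h`. -/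
def linePrediction (c : ℕ → K) (d : ℕ) (f : V → W) (x h : V) : W :=
  ∑ i ∈ range (d + 1), c (i + 1) • f (x + ((i + 1 : ℕ) : K) • h)

/-- The pairs `(x, h)` at which the prediction along the line through `x` fails. -/
def badPairs (c : ℕ → K) (d : ℕ) (f : V → W) : Finset (V × V) :=
  {z | f z.1 ≠ linePrediction c d f z.1 z.2}

theorem card_linePrediction_ne_le (c : ℕ → K) {d : ℕ} (hd : ∀ i ≤ d, ((i + 1 : ℕ) : K) ≠ 0)
    (f : V → W) (x : V) :
    #{z : V × V | linePrediction c d f x z.1 ≠ linePrediction c d f x z.2} ≤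
      2 * (d + 1) * #(badPairs c d f) := by
  classical
  have hleft : ∀ i ∈ range (d + 1),
      #{z : V × V | (x + ((i + 1 : ℕ) : K) • z.1, z.2) ∈ badPairs c d f} ≤
        #(badPairs c d f) := by
    intro i hi
    refine card_le_card_of_injOn (fun z => (x + ((i + 1 : ℕ) : K) • z.1, z.2)) (by
      intro z hz; simpa using hz) ?_
    rintro ⟨a, b⟩ - ⟨a', b'⟩ - h
    have hi := hd i (by simpa [Nat.lt_succ_iff] using hi)
    simp only [Prod.mk.injEq, add_right_inj] at h
    exact Prod.ext (smul_right_injective V hi h.1) h.2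
  have hright : ∀ i ∈ range (d + 1),
      #{z : V × V | (x + ((i + 1 : ℕ) : K) • z.2, z.1) ∈ badPairs c d f} ≤
        #(badPairs c d f) := by
    intro i hi
    refine card_le_card_of_injOn (fun z => (x + ((i + 1 : ℕ) : K) • z.2, z.1)) (by
      intro z hz; simpa using hz) ?_
    rintro ⟨a, b⟩ - ⟨a', b'⟩ - h
    have hi := hd i (by simpa [Nat.lt_succ_iff] using hi)
    simp only [Prod.mk.injEq, add_right_inj] at h
    exact Prod.ext h.2 (smul_right_injective V hi h.1)
  have hsub : ({z : V × V | linePrediction c d f x z.1 ≠ linePrediction c d f x z.2} :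
      Finset (V × V)) ⊆
      ({z | ∃ i ∈ range (d + 1), (x + ((i + 1 : ℕ) : K) • z.1, z.2) ∈ badPairs c d f} :
        Finset (V × V)) ∪
      ({z | ∃ i ∈ range (d + 1), (x + ((i + 1 : ℕ) : K) • z.2, z.1) ∈ badPairs c d f} :
        Finset (V × V)) := by
    rintro ⟨a, b⟩ hz
    simp only [mem_filter, mem_univ, true_and, mem_union] at hz ⊢
    by_contra! hcon
    refine hz ?_
    obtain ⟨h₁, h₂⟩ := hcon
    simp only [badPairs, mem_filter, mem_univ, true_and, not_not] at h₁ h₂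
    have e₁ : linePrediction c d f x a = ∑ i ∈ range (d + 1), c (i + 1) •
        linePrediction c d f (x + ((i + 1 : ℕ) : K) • a) b :=
      sum_congr rfl fun i hi => by rw [h₁ i hi]
    have e₂ : linePrediction c d f x b = ∑ i ∈ range (d + 1), c (i + 1) •
        linePrediction c d f (x + ((i + 1 : ℕ) : K) • b) a :=
      sum_congr rfl fun i hi => by rw [h₂ i hi]
    rw [e₁, e₂]
    simp only [linePrediction, smul_sum]
    rw [sum_comm]
    refine sum_congr rfl fun i _ => sum_congr rfl fun j _ => ?_
    rw [smul_comm, add_right_comm]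
  calc _ ≤ _ := card_le_card hsub
    _ ≤ _ := card_union_le _ _
    _ ≤ (d + 1) * #(badPairs c d f) + (d + 1) * #(badPairs c d f) := by
      refine add_le_add ((card_filter_exists_le hleft).trans_eq ?_)
          ((card_filter_exists_le hright).trans_eq ?_) <;> rw [card_range]
    _ = _ := by ring

theorem exists_card_mul_card_linePrediction_ne_le (c : ℕ → K) {d : ℕ}
    (hd : ∀ i ≤ d, ((i + 1 : ℕ) : K) ≠ 0) (f : V → W) (x : V) :
    ∃ w : W, Fintype.card V * #{h | linePrediction c d f x h ≠ w} ≤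
      2 * (d + 1) * #(badPairs c d f) := by
  classical
  obtain ⟨a, -, ha⟩ := exists_min_image (univ : Finset V)
    (fun a => #{h | linePrediction c d f x h ≠ linePrediction c d f x a}) ⟨0, mem_univ _⟩
  refine ⟨linePrediction c d f x a, le_trans ?_ (card_linePrediction_ne_le c hd f x)⟩
  have := card_nsmul_le_sum univ _ _ ha
  rw [card_univ, smul_eq_mul] at this
  refine this.trans_eq ?_
  simp only [card_filter]
  rw [← univ_product_univ, sum_product_right]

theorem card_mul_card_ne_le (c : ℕ → K) {d : ℕ} (f g : V → W)
    (hb : 2 * (d + 2) ^ 2 * #(badPairs c d f) < Fintype.card V ^ 2)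
    (hg : ∀ x, Fintype.card V * #{h | linePrediction c d f x h ≠ g x} ≤
      2 * (d + 1) * #(badPairs c d f)) :
    Fintype.card V * #{x | f x ≠ g x} ≤ 2 * #(badPairs c d f) := by
  classical
  have key : ∀ x ∈ ({x | f x ≠ g x} : Finset V),
      Fintype.card V ≤ 2 * #{h | f x ≠ linePrediction c d f x h} := by
    intro x hx
    have hx : f x ≠ g x := by simpa using hx
    have hcover : (univ : Finset V) ⊆ ({h | f x ≠ linePrediction c d f x h} : Finset V) ∪
        ({h | linePrediction c d f x h ≠ g x} : Finset V) := by
      intro h _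
      simp only [mem_union, mem_filter, mem_univ, true_and]
      by_contra! hcon
      exact hx (hcon.1.trans hcon.2)
    have h₁ := (card_le_card hcover).trans (card_union_le _ _)
    rw [card_univ] at h₁
    have h₂ : 2 * #{h | linePrediction c d f x h ≠ g x} ≤ Fintype.card V := by
      by_contra! hlt
      have h₃ := hg x
      have h₄ : Fintype.card V ^ 2 ≤
          2 * (Fintype.card V * #{h | linePrediction c d f x h ≠ g x}) := by
        rw [sq, mul_left_comm]
        exact Nat.mul_le_mul_left _ hlt.le
      nlinarith
    omega
  have hsum : #(badPairs c d f) = ∑ x, #{h | f x ≠ linePrediction c d f x h} := by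
    simp only [badPairs, card_filter]
    rw [← univ_product_univ, sum_product]
  calc Fintype.card V * #{x | f x ≠ g x}
      ≤ ∑ x ∈ ({x | f x ≠ g x} : Finset V), 2 * #{h | f x ≠ linePrediction c d f x h} := by
        simpa [mul_comm] using card_nsmul_le_sum _ _ _ key
    _ ≤ ∑ x, 2 * #{h | f x ≠ linePrediction c d f x h} :=
        sum_le_sum_of_subset (filter_subset _ _)
    _ = _ := by rw [← mul_sum, ← hsum]

theorem sum_smul_correction_eq_zero (c : ℕ → K) (hc : c 0 = -1) {d : ℕ}
    (hd : ∀ i ≤ d, ((i + 1 : ℕ) : K) ≠ 0) (f g : V → W)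
    (hb : 2 * (d + 2) ^ 2 * #(badPairs c d f) < Fintype.card V ^ 2)
    (hg : ∀ x, Fintype.card V * #{h | linePrediction c d f x h ≠ g x} ≤
      2 * (d + 1) * #(badPairs c d f)) (x h : V) :
    ∑ i ∈ range (d + 2), c i • g (x + (i : K) • h) = 0 := by
  classical
  have hcorr : ∀ i ∈ range (d + 2), #{z : V × V | linePrediction c d f (x + (i : K) • h)
      (z.1 + (i : K) • z.2) ≠ g (x + (i : K) • h)} ≤ 2 * (d + 1) * #(badPairs c d f) := by
    intro i _
    refine le_trans ?_ (hg (x + (i : K) • h))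
    rw [mul_comm, ← card_univ, ← card_product]
    refine card_le_card_of_injOn (fun z => (z.1 + (i : K) • z.2, z.2)) (by
      intro z hz; simpa using hz) ?_
    rintro ⟨a, b⟩ - ⟨a', b'⟩ - h
    simp only [Prod.mk.injEq] at h
    obtain ⟨h₁, rfl⟩ := h
    simpa using h₁
  have hline : ∀ j ∈ range (d + 1),
      #{z : V × V | (x + ((j + 1 : ℕ) : K) • z.1, h + ((j + 1 : ℕ) : K) • z.2) ∈
        badPairs c d f} ≤ #(badPairs c d f) := by
    intro j hj
    refine card_le_card_of_injOn
      (fun z => (x + ((j + 1 : ℕ) : K) • z.1, h + ((j + 1 : ℕ) : K) • z.2)) (by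
      intro z hz; simpa using hz) ?_
    rintro ⟨a, b⟩ - ⟨a', b'⟩ - h
    have hj := hd j (by simpa [Nat.lt_succ_iff] using hj)
    simp only [Prod.mk.injEq, add_right_inj] at h
    exact Prod.ext (smul_right_injective V hj h.1) (smul_right_injective V hj h.2)
  have hlt : #(({z | ∃ i ∈ range (d + 2), linePrediction c d f (x + (i : K) • h)
        (z.1 + (i : K) • z.2) ≠ g (x + (i : K) • h)} : Finset (V × V)) ∪
      ({z | ∃ j ∈ range (d + 1), (x + ((j + 1 : ℕ) : K) • z.1, h + ((j + 1 : ℕ) : K) • z.2) ∈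
        badPairs c d f} : Finset (V × V))) < #(univ : Finset (V × V)) := by
    calc _ ≤ _ := card_union_le _ _
      _ ≤ (d + 2) * (2 * (d + 1) * #(badPairs c d f)) + (d + 1) * #(badPairs c d f) := by
        refine add_le_add ((card_filter_exists_le hcorr).trans_eq ?_)
          ((card_filter_exists_le hline).trans_eq ?_) <;> rw [card_range]
      _ ≤ 2 * (d + 2) ^ 2 * #(badPairs c d f) := by nlinarith
      _ < _ := by simpa [sq] using hb
  obtain ⟨⟨a, b⟩, -, hab⟩ := exists_mem_notMem_of_card_lt_card hlt
  simp only [mem_union, mem_filter, mem_univ, true_and, not_or, not_exists, not_and,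
    not_not, badPairs] at hab
  obtain ⟨h₁, h₂⟩ := hab
  have hzero : ∀ j ∈ range (d + 1), ∑ i ∈ range (d + 2),
      c i • f (x + ((j + 1 : ℕ) : K) • a + (i : K) • (h + ((j + 1 : ℕ) : K) • b)) = 0 := by
    intro j hj
    rw [sum_range_succ', hc]
    have := h₂ j hj
    simp only [linePrediction] at this
    rw [← this]
    simp
  calc _ = ∑ i ∈ range (d + 2), c i •
        linePrediction c d f (x + (i : K) • h) (a + (i : K) • b) :=
        sum_congr rfl fun i hi => by rw [h₁ i hi]
    _ = ∑ j ∈ range (d + 1), c (j + 1) • ∑ i ∈ range (d + 2),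
        c i • f (x + ((j + 1 : ℕ) : K) • a + (i : K) • (h + ((j + 1 : ℕ) : K) • b)) := by
        simp only [linePrediction, smul_sum]
        rw [sum_comm]
        refine sum_congr rfl fun j _ => sum_congr rfl fun i _ => ?_
        rw [smul_comm]
        congr 3
        module
    _ = 0 := sum_eq_zero fun j hj => by rw [hzero j hj, smul_zero]

end Counting

section Difference

variable {K U V W : Type*} [AddCommGroup U] [AddCommGroup V] [AddCommGroup W]

/-- The iterated difference of `f` with steps `a 0, …, a (n - 1)`. -/
def mixedDiff : (ℕ → V) → ℕ → (V → W) → V → W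
  | _, 0, f => f
  | a, n + 1, f => mixedDiff (fun j => a (j + 1)) n (fwdDiff (a 0) f)

theorem mixedDiff_zero_right (a : ℕ → V) (n : ℕ) : mixedDiff a n (0 : V → W) = 0 := by
  induction n generalizing a with
  | zero => rfl
  | succ n ih =>
    have h : fwdDiff (a 0) (0 : V → W) = 0 := by ext; simp [fwdDiff]
    rw [mixedDiff, h, ih]

theorem mixedDiff_eq_zero_of_step_eq_zero {a : ℕ → V} {n j : ℕ} (hj : j < n) (ha : a j = 0)
    (f : V → W) : mixedDiff a n f = 0 := by
  induction n generalizing a j f with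
  | zero => omega
  | succ n ih =>
    cases j with
    | zero =>
      have h : fwdDiff (a 0) f = 0 := by ext; simp [fwdDiff, ha]
      rw [mixedDiff, h, mixedDiff_zero_right]
    | succ j => exact ih (a := fun j => a (j + 1)) (by omega) ha _

theorem mixedDiff_const (h : V) (n : ℕ) (f : V → W) :
    mixedDiff (fun _ => h) n f = (fwdDiff h)^[n] f := by
  induction n generalizing f with
  | zero => rfl
  | succ n ih => exact ih _

theorem mixedDiff_comp (φ : U →+ V) (a : ℕ → U) (n : ℕ) (f : V → W) :
    mixedDiff a n (f ∘ φ) = mixedDiff (fun j => φ (a j)) n f ∘ φ := by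
  induction n generalizing a f with
  | zero => rfl
  | succ n ih =>
    have h : fwdDiff (a 0) (f ∘ φ) = fwdDiff (φ (a 0)) f ∘ φ := by ext; simp [fwdDiff]
    rw [mixedDiff, h, ih]
    rfl

theorem mixedDiff_fwdDiff_iter_eq_zero {f : V → W} {n k : ℕ}
    (hf : ∀ a, mixedDiff a (n + k) f = 0) (h : V) (a : ℕ → V) :
    mixedDiff a n ((fwdDiff h)^[k] f) = 0 := by
  induction k generalizing f with
  | zero => exact hf a
  | succ k ih => exact ih fun b => hf (fun j => Nat.casesOn (motive := fun _ => V) j h b)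

variable [Field K] [Module K V] [Module K W]

theorem sum_smul_mixedDiff_eq_zero (s : Finset ℕ) (c : ℕ → K) (F : ℕ → V → W)
    (hF : ∀ x y, ∑ i ∈ s, c i • F i (x + (i : K) • y) = 0) (u v : ℕ → V) (n : ℕ) (x y : V) :
    ∑ i ∈ s, c i • mixedDiff (fun j => u j + (i : K) • v j) n (F i) (x + (i : K) • y) = 0 := by
  induction n generalizing F u v with
  | zero => exact hF x y
  | succ n ih =>
    refine ih (fun i => fwdDiff (u 0 + (i : K) • v 0) (F i)) (fun x y => ?_)
      (fun j => u (j + 1)) (fun j => v (j + 1))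
    have h := hF (x + u 0) (y + v 0)
    rw [← sub_eq_zero.2 (h.trans (hF x y).symm), ← sum_sub_distrib]
    refine sum_congr rfl fun i _ => ?_
    rw [fwdDiff, smul_sub]
    congr 3
    module

/-- If all differences of order `n` with equal steps vanish, then so do those with arbitrary
steps. -/
theorem mixedDiff_eq_zero_of_sum_smul_eq_zero {n : ℕ}
    (hn : ∀ i < n, ((i + 1 : ℕ) : K) ≠ 0) (c : ℕ → K) (hc : c 0 = -1) (f : V → W)
    (hf : ∀ x y, ∑ i ∈ range (n + 1), c i • f (x + (i : K) • y) = 0) (a : ℕ → V) :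
    mixedDiff a n f = 0 := by
  ext x
  have h := sum_smul_mixedDiff_eq_zero (range (n + 1)) c (fun _ => f) hf a
    (fun j => -(((j + 1 : ℕ) : K)⁻¹ • a j)) n x 0
  rw [sum_range_succ', sum_eq_zero, hc] at h
  · simpa using h
  · intro i hi
    have hi : i < n := by simpa using hi
    rw [mixedDiff_eq_zero_of_step_eq_zero hi]
    · simp
    · rw [smul_neg, smul_smul, mul_inv_cancel₀ (hn i hi), one_smul, add_neg_cancel]

end Difference

theorem exists_totalDegree_le_eval_eq {p : ℕ} [Fact p.Prime] {m d : ℕ} (hd : d < p)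
    (f : (Fin m → ZMod p) → ZMod p) (hf : ∀ a, mixedDiff a (d + 1) f = 0) :
    ∃ P : MvPolynomial (Fin m) (ZMod p), P.totalDegree ≤ d ∧
      ∀ x, f x = MvPolynomial.eval x P := by
  induction m generalizing d with
  | zero => exact ⟨MvPolynomial.C (f 0), by simp, fun x => by simp [Subsingleton.elim x 0]⟩
  | succ m ih =>
    let e : Fin (m + 1) → ZMod p := Pi.single 0 1
    let φ : (Fin m → ZMod p) →+ (Fin (m + 1) → ZMod p) :=
      { toFun := Fin.cons (α := fun _ => ZMod p) 0
        map_zero' := by ext i; cases i using Fin.cases <;> simp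
        map_add' := fun x y => by ext i; cases i using Fin.cases <;> simp }
    have hQ : ∀ k, ∃ Q : MvPolynomial (Fin m) (ZMod p), k ≤ d → Q.totalDegree ≤ d - k ∧
        ∀ x, (fwdDiff e)^[k] f (φ x) = MvPolynomial.eval x Q := by
      intro k
      by_cases hk : k ≤ d
      · obtain ⟨Q, hQ⟩ := ih (d := d - k) (by omega) ((fwdDiff e)^[k] f ∘ φ) fun a => by
          rw [mixedDiff_comp, mixedDiff_fwdDiff_iter_eq_zero]
          · rfl
          · rwa [show d - k + 1 + k = d + 1 by omega]
        exact ⟨Q, fun _ => hQ⟩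
      · exact ⟨0, fun h => absurd h hk⟩
    choose Q hQ using hQ
    refine ⟨∑ k ∈ range (d + 1), MvPolynomial.C ((k.factorial : ZMod p)⁻¹) *
      Polynomial.aeval (MvPolynomial.X 0) (descPochhammer (ZMod p) k) *
      MvPolynomial.rename Fin.succ (Q k), ?_, fun x => ?_⟩
    · refine MvPolynomial.totalDegree_finsetSum_le fun k hk => ?_
      have hk : k ≤ d := by simpa [Nat.lt_succ_iff] using hk
      have h₁ : (Polynomial.aeval (MvPolynomial.X (R := ZMod p) (0 : Fin (m + 1)))
          (descPochhammer (ZMod p) k)).totalDegree ≤ k := by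
        rw [Polynomial.aeval_eq_sum_range, descPochhammer_natDegree]
        refine MvPolynomial.totalDegree_finsetSum_le fun i hi => ?_
        refine (MvPolynomial.totalDegree_smul_le _ _).trans ?_
        rw [MvPolynomial.totalDegree_X_pow]
        simpa [Nat.lt_succ_iff] using hi
      have h₂ := (MvPolynomial.totalDegree_rename_le Fin.succ (Q k)).trans (hQ k hk).1
      have h₃ := MvPolynomial.totalDegree_mul (MvPolynomial.C ((k.factorial : ZMod p)⁻¹) *
        Polynomial.aeval (MvPolynomial.X 0) (descPochhammer (ZMod p) k))
        (MvPolynomial.rename Fin.succ (Q k))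
      have h₄ := MvPolynomial.totalDegree_mul (MvPolynomial.C ((k.factorial : ZMod p)⁻¹))
        (Polynomial.aeval (MvPolynomial.X (0 : Fin (m + 1))) (descPochhammer (ZMod p) k))
      rw [MvPolynomial.totalDegree_C] at h₄
      omega
    · have hx : x = φ (Fin.tail x) + (x 0).val • e := by
        ext i
        cases i using Fin.cases <;> simp [φ, e, Fin.tail, -ZMod.natCast_val, ZMod.natCast_zmod_val]
      have hterm : ∀ k ≤ d, MvPolynomial.eval x (MvPolynomial.C ((k.factorial : ZMod p)⁻¹) *
          Polynomial.aeval (MvPolynomial.X 0) (descPochhammer (ZMod p) k) *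
          MvPolynomial.rename Fin.succ (Q k)) =
          (x 0).val.choose k • (fwdDiff e)^[k] f (φ (Fin.tail x)) := by
        intro k hk
        have hk0 : (k.factorial : ZMod p) ≠ 0 := by
          rw [Ne, ZMod.natCast_eq_zero_iff, (Fact.out : p.Prime).dvd_factorial]
          omega
        have hdp : Polynomial.eval (x 0) (descPochhammer (ZMod p) k) =
            (k.factorial : ZMod p) * ((x 0).val.choose k : ZMod p) := by
          conv_lhs => rw [← ZMod.natCast_zmod_val (x 0)]
          rw [descPochhammer_eval_eq_descFactorial, Nat.descFactorial_eq_factorial_mul_choose,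
            Nat.cast_mul]
        have hev : MvPolynomial.eval x (Polynomial.aeval (MvPolynomial.X 0)
            (descPochhammer (ZMod p) k)) = Polynomial.eval (x 0) (descPochhammer (ZMod p) k) := by
          rw [← MvPolynomial.coe_aeval_eq_eval, RingHom.coe_coe, ← Polynomial.aeval_algHom_apply,
            MvPolynomial.aeval_X, Polynomial.coe_aeval_eq_eval]
        rw [map_mul, map_mul, hev, hdp, MvPolynomial.eval_C, MvPolynomial.eval_rename,
          inv_mul_cancel_left₀ hk0, (hQ k hk).2, nsmul_eq_mul]
        rfl
      have hhigh : ∀ k, d < k → (fwdDiff e)^[k] f = 0 := fun k hk => by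
        obtain ⟨j, rfl⟩ := Nat.exists_eq_add_of_le' (Nat.succ_le_of_lt hk)
        rw [Function.iterate_add_apply, ← mixedDiff_const e (d + 1), hf, ← mixedDiff_const,
          mixedDiff_zero_right]
      rw [map_sum, sum_congr rfl fun k hk => hterm k (by simpa [Nat.lt_succ_iff] using hk)]
      conv_lhs => rw [hx, shift_eq_sum_fwdDiff_iter e f]
      set n := (x 0).val
      trans ∑ k ∈ range (max (n + 1) (d + 1)),
        n.choose k • (fwdDiff e)^[k] f (φ (Fin.tail x))
      · refine sum_subset (range_subset_range.2 (le_max_left _ _)) fun k _ hk => ?_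
        rw [Nat.choose_eq_zero_of_lt (by simpa [Nat.lt_succ_iff] using hk), zero_smul]
      · refine (sum_subset (range_subset_range.2 (le_max_right _ _)) fun k _ hk => ?_).symm
        rw [hhigh k (by simpa [Nat.lt_succ_iff] using hk), Pi.zero_apply, smul_zero]


theorem stmt_3 (p : ℕ) [Fact p.Prime] (d m ℓ : ℕ) (hp : 2 * d < p) (δ : ℝ) (hδ : 0 < δ)
    (f : (Fin m → ZMod p) → (Fin ℓ → ZMod p))
    (hfar : ∀ g : (Fin m → ZMod p) → (Fin ℓ → ZMod p),
      (∀ j : Fin ℓ, ∃ P : MvPolynomial (Fin m) (ZMod p), P.totalDegree ≤ d ∧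
        ∀ x : Fin m → ZMod p, g x j = MvPolynomial.eval x P) →
      δ * (p : ℝ) ^ m < ((Finset.univ.filter fun x : Fin m → ZMod p => f x ≠ g x).card : ℝ)) :
    (min δ (1 / ((d : ℝ) + 2) ^ 2) / 2) * (p : ℝ) ^ (2 * m) ≤
      ((Finset.univ.filter fun xh : (Fin m → ZMod p) × (Fin m → ZMod p) =>
        ∑ i ∈ Finset.range (d + 2),
          ((-1 : ZMod p) ^ (i + 1) * ((d + 1).choose i : ZMod p)) •
            f (xh.1 + (i : ZMod p) • xh.2) ≠ 0).card : ℝ) := by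
  classical
  by_contra! hlt
  have hp' : d + 1 < p := by
    have := (Fact.out : p.Prime).two_le
    omega
  have hd : ∀ i ≤ d, ((i + 1 : ℕ) : ZMod p) ≠ 0 := fun i hi h =>
    absurd (Nat.le_of_dvd (by omega) ((ZMod.natCast_eq_zero_iff _ _).1 h)) (by omega)
  let c : ℕ → ZMod p := fun i => (-1 : ZMod p) ^ (i + 1) * ((d + 1).choose i : ZMod p)
  have hc : c 0 = -1 := by simp [c]
  have hbad : (Finset.univ.filter fun xh : (Fin m → ZMod p) × (Fin m → ZMod p) =>
        ∑ i ∈ Finset.range (d + 2),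
          ((-1 : ZMod p) ^ (i + 1) * ((d + 1).choose i : ZMod p)) •
            f (xh.1 + (i : ZMod p) • xh.2) ≠ 0) = badPairs c d f := by
    refine filter_congr fun z _ => not_congr ?_
    change ∑ i ∈ range (d + 2), c i • f (z.1 + (i : ZMod p) • z.2) = 0 ↔ _
    rw [sum_range_succ', hc, linePrediction, eq_comm (a := f z.1), ← sub_eq_zero (b := f z.1)]
    simp [sub_eq_add_neg]
  rw [hbad] at hlt
  have hcard : Fintype.card (Fin m → ZMod p) = p ^ m := by simp
  have hN : (0 : ℝ) < (p : ℝ) ^ (2 * m) := by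
    have := (Fact.out : p.Prime).pos
    positivity
  have hb : 2 * (d + 2) ^ 2 * #(badPairs c d f) < Fintype.card (Fin m → ZMod p) ^ 2 := by
    rw [hcard, ← pow_mul, mul_comm m, ← Nat.cast_lt (α := ℝ)]
    push_cast
    have h := hlt.trans_le (mul_le_mul_of_nonneg_right
      (div_le_div_of_nonneg_right (min_le_right _ _) zero_le_two) hN.le)
    rw [div_div, one_div_mul_eq_div, lt_div_iff₀ (by positivity)] at h
    linarith
  choose g hg using exists_card_mul_card_linePrediction_ne_le c hd f
  have hdeg : ∀ j : Fin ℓ, ∃ P : MvPolynomial (Fin m) (ZMod p), P.totalDegree ≤ d ∧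
      ∀ x : Fin m → ZMod p, g x j = MvPolynomial.eval x P := fun j =>
    exists_totalDegree_le_eval_eq (by omega) (fun x => g x j) <|
      mixedDiff_eq_zero_of_sum_smul_eq_zero (fun i hi => hd i (by omega)) c hc _ fun x y => by
        simpa using congrFun (sum_smul_correction_eq_zero c hc hd f g hb hg x y) j
  have hclose := card_mul_card_ne_le c f g hb hg
  rw [hcard, ← Nat.cast_le (α := ℝ)] at hclose
  push_cast at hclose
  have hfar' := hfar g hdeg
  have hpm : (0 : ℝ) < (p : ℝ) ^ m := by
    have := (Fact.out : p.Prime).pos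
    positivity
  have h := hlt.trans_le (mul_le_mul_of_nonneg_right
    (div_le_div_of_nonneg_right (min_le_left _ _) zero_le_two) hN.le)
  rw [two_mul, pow_add] at h
  have := mul_lt_mul_of_pos_left hfar' hpm
  linarith
end

section
/- Let p be a prime, d, m, ℓ natural numbers, and ρ ≥ 0 a real number. For 0 ≤ i ≤ d+1 set α_i = (-1)^{i+1}·C(d+1, i) ∈ ZMod p. Let f : (Fin m → ZMod p) → (Fin ℓ → ZMod p) satisfy: the number of pairs (x, h) with Σ_{i=0}^{d+1} α_i • f(x + i • h) ≠ 0 is at most ρ·p^{2m}. Let g : (Fin m → ZMod p) → (Fin ℓ → ZMod p) be a majority decoding of f, i.e., for every x and every v ∈ (Fin ℓ → ZMod p), the number of h with Σ_{i=1}^{d+1} α_i • f(x + i • h) = v is at most the number of h with Σ_{i=1}^{d+1} α_i • f(x + i • h) = g(x). Then for every x ∈ (Fin m → ZMod p), the number of h with g(x) = Σ_{i=1}^{d+1} α_i • f(x + i • h) is at least (1 − 2(d+1)ρ)·p^m. -/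
open Finset in
/-- In characteristic `p`, the `n`-th forward difference vanishes identically as soon as `p ≤ n`. -/
theorem fwdDiff_iter_eq_zero_of_char_le {p : ℕ} [Fact p.Prime] {V W : Type*}
    [AddCommGroup V] [Module (ZMod p) V] [AddCommGroup W] [Module (ZMod p) W]
    {n : ℕ} (hn : p ≤ n) (f : V → W) (h : V) : (fwdDiff h)^[n] f = 0 := by
  have hp := (Fact.out : p.Prime)
  have hshift : (fwdDiff h)^[p] f = 0 := by
    ext y
    have hph : (p : ℕ) • h = 0 := by
      rw [← Nat.cast_smul_eq_nsmul (ZMod p), CharP.cast_eq_zero, zero_smul]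
    have hmid : ∀ k ∈ range p, k ≠ 0 →
        ((-1 : ℤ) ^ (p - k) * (p.choose k : ℤ)) • f (y + k • h) = 0 := by
      intro k hk hk0
      have hz : ((p.choose k : ℕ) : ZMod p) = 0 :=
        (ZMod.natCast_eq_zero_iff _ _).2
          (hp.dvd_choose_self hk0 (mem_range.1 hk))
      rw [← Int.cast_smul_eq_zsmul (ZMod p)]
      push_cast
      rw [hz, mul_zero, zero_smul]
    rw [fwdDiff_iter_eq_sum_shift, sum_range_succ,
      sum_eq_single_of_mem 0 (mem_range.2 hp.pos) hmid, hph,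
      ← Int.cast_smul_eq_zsmul (ZMod p), ← Int.cast_smul_eq_zsmul (ZMod p)]
    simp [ZMod.pow_card]
  obtain ⟨k, rfl⟩ := Nat.exists_eq_add_of_le' hn
  rw [Function.iterate_add_apply, hshift]
  clear hn
  induction k with
  | zero => rfl
  | succ k ih =>
    rw [Function.iterate_succ_apply', ih]
    ext y
    simp [fwdDiff]

open Finset in
theorem sum_alternating_choose_smul_eq_zero_of_char_le {p : ℕ} [Fact p.Prime] {V W : Type*}
    [AddCommGroup V] [Module (ZMod p) V] [AddCommGroup W] [Module (ZMod p) W]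
    {n : ℕ} (hn : p ≤ n) (f : V → W) (y h : V) :
    ∑ i ∈ range (n + 1), ((-1 : ZMod p) ^ (i + 1) * (n.choose i : ZMod p)) •
      f (y + (i : ZMod p) • h) = 0 := by
  have hΔ := congrFun (fwdDiff_iter_eq_zero_of_char_le hn f h) y
  rw [fwdDiff_iter_eq_sum_shift] at hΔ
  rw [← smul_zero ((-1 : ZMod p) ^ (n + 1)), ← Pi.zero_apply (M := fun _ : V => W) y, ← hΔ,
    smul_sum]
  refine sum_congr rfl fun i hi => ?_
  obtain ⟨k, rfl⟩ := Nat.exists_eq_add_of_le (Nat.lt_succ_iff.1 (mem_range.1 hi))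
  rw [← Int.cast_smul_eq_zsmul (ZMod p), smul_smul, Nat.cast_smul_eq_nsmul]
  congr 1
  push_cast
  rw [Nat.add_sub_cancel_left, ← mul_assoc, ← pow_add,
    show i + k + 1 + k = i + 1 + 2 * k by ring, pow_add _ (i + 1), pow_mul]
  simp

open Finset in
/-- If the weighted sums of `f` vanish along all rows and columns of the grid `x + i • h + j • k`
other than the two through `x`, then the weighted sums along those two, without `x`, agree. -/
theorem sum_Icc_smul_eq_of_grid {R V W : Type*} [CommRing R] [AddCommGroup V] [Module R V]
    [AddCommGroup W] [Module R W] {n : ℕ} {α : ℕ → R} (hα : α 0 = -1) {f : V → W} {x h k : V}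
    (hrow : ∀ i ∈ Icc 1 n, ∑ j ∈ range (n + 1), α j • f (x + (i : R) • h + (j : R) • k) = 0)
    (hcol : ∀ j ∈ Icc 1 n, ∑ i ∈ range (n + 1), α i • f (x + (j : R) • k + (i : R) • h) = 0) :
    ∑ i ∈ Icc 1 n, α i • f (x + (i : R) • h) = ∑ j ∈ Icc 1 n, α j • f (x + (j : R) • k) := by
  have hval : ∀ y u : V, ∑ j ∈ range (n + 1), α j • f (y + (j : R) • u) = 0 →
      f y = ∑ j ∈ Icc 1 n, α j • f (y + (j : R) • u) := by
    intro y u hs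
    rw [range_eq_Ico, sum_eq_sum_Ico_succ_bot n.succ_pos] at hs
    simp only [hα, Nat.cast_zero, zero_smul, add_zero, neg_smul, one_smul] at hs
    exact neg_add_eq_zero.1 hs
  calc
    _ = ∑ i ∈ Icc 1 n, ∑ j ∈ Icc 1 n, α i • α j • f (x + (i : R) • h + (j : R) • k) :=
      sum_congr rfl fun i hi => by rw [hval _ k (hrow i hi), smul_sum]
    _ = ∑ j ∈ Icc 1 n, ∑ i ∈ Icc 1 n, α j • α i • f (x + (j : R) • k + (i : R) • h) := by
      rw [sum_comm]
      refine sum_congr rfl fun j _ => sum_congr rfl fun i _ => ?_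
      rw [smul_comm, add_right_comm]
    _ = _ := sum_congr rfl fun j hj => by rw [hval _ h (hcol j hj), smul_sum]

open Finset in
/-- The collision probability of `F` is at most the probability of its most likely value. -/
theorem card_collision_le_card_mul {H W : Type*} [Fintype H] [DecidableEq W] (F : H → W) {N : ℕ}
    (hN : ∀ v, #{h | F h = v} ≤ N) : #{q : H × H | F q.1 = F q.2} ≤ Fintype.card H * N := by
  classical
  rw [card_filter, Fintype.sum_prod_type]
  calc
    _ ≤ ∑ _h : H, N := sum_le_sum fun h _ => by
      rw [← card_filter]
      simpa only [eq_comm] using hN (F h)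
    _ = _ := by simp

open Finset in
theorem card_filter_add_smul_le {K V : Type*} [Field K] [AddCommGroup V] [Module K V] [Fintype V]
    (P : V × V → Prop) [DecidablePred P] {c : K} (hc : c ≠ 0) (x : V) :
    #{q : V × V | P (x + c • q.1, q.2)} ≤ #{q | P q} := by
  refine card_le_card_of_injOn (fun q => (x + c • q.1, q.2)) (fun q hq => by simpa using hq) ?_
  rintro ⟨a, b⟩ - ⟨a', b'⟩ - hq
  obtain ⟨h₁, h₂⟩ := Prod.mk.inj hq
  exact Prod.ext (smul_right_injective V hc (add_left_cancel h₁)) h₂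

theorem stmt_4 (p : ℕ) [Fact p.Prime] (d m ℓ : ℕ) (ρ : ℝ) (hρ : 0 ≤ ρ)
    (f g : (Fin m → ZMod p) → (Fin ℓ → ZMod p))
    (hf : ((Finset.univ.filter fun xh : (Fin m → ZMod p) × (Fin m → ZMod p) =>
        ∑ i ∈ Finset.range (d + 2),
          ((-1 : ZMod p) ^ (i + 1) * ((d + 1).choose i : ZMod p)) •
            f (xh.1 + (i : ZMod p) • xh.2) ≠ 0).card : ℝ) ≤ ρ * (p : ℝ) ^ (2 * m))
    (hg : ∀ x : Fin m → ZMod p, ∀ v : Fin ℓ → ZMod p,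
      (Finset.univ.filter fun h : Fin m → ZMod p =>
        ∑ i ∈ Finset.Icc 1 (d + 1),
          ((-1 : ZMod p) ^ (i + 1) * ((d + 1).choose i : ZMod p)) •
            f (x + (i : ZMod p) • h) = v).card ≤
      (Finset.univ.filter fun h : Fin m → ZMod p =>
        ∑ i ∈ Finset.Icc 1 (d + 1),
          ((-1 : ZMod p) ^ (i + 1) * ((d + 1).choose i : ZMod p)) •
            f (x + (i : ZMod p) • h) = g x).card) :
    ∀ x : Fin m → ZMod p,
      (1 - 2 * ((d : ℝ) + 1) * ρ) * (p : ℝ) ^ m ≤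
      ((Finset.univ.filter fun h : Fin m → ZMod p =>
        g x = ∑ i ∈ Finset.Icc 1 (d + 1),
          ((-1 : ZMod p) ^ (i + 1) * ((d + 1).choose i : ZMod p)) •
            f (x + (i : ZMod p) • h)).card : ℝ) := by
  classical
  intro x
  set α : ℕ → ZMod p := fun i => (-1 : ZMod p) ^ (i + 1) * ((d + 1).choose i : ZMod p) with hα
  let F : (Fin m → ZMod p) → (Fin ℓ → ZMod p) := fun h =>
    ∑ i ∈ Finset.Icc 1 (d + 1), α i • f (x + (i : ZMod p) • h)
  let P : (Fin m → ZMod p) × (Fin m → ZMod p) → Prop := fun q =>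
    ∑ i ∈ Finset.range (d + 2), α i • f (q.1 + (i : ZMod p) • q.2) ≠ 0
  let B := Finset.univ.filter P
  let N := (Finset.univ.filter fun h => F h = g x).card
  have hB : (B.card : ℝ) ≤ ρ * (p : ℝ) ^ (2 * m) := by convert hf
  have hrow : ∀ i ∈ Finset.Icc 1 (d + 1),
      (Finset.univ.filter fun q : (Fin m → ZMod p) × (Fin m → ZMod p) =>
        P (x + (i : ZMod p) • q.1, q.2)).card ≤ B.card := by
    intro i hi
    obtain ⟨hi₁, hi₂⟩ := Finset.mem_Icc.1 hi
    by_cases hpd : p ≤ d + 1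
    · have hP : ∀ q, ¬ P q := fun q => not_not.2
        (sum_alternating_choose_smul_eq_zero_of_char_le hpd f q.1 q.2)
      simp [hP]
    · refine card_filter_add_smul_le P (fun h => ?_) x
      exact absurd (Nat.le_of_dvd hi₁ ((ZMod.natCast_eq_zero_iff _ _).1 h)) (by omega)
  have hcol : ∀ i ∈ Finset.Icc 1 (d + 1),
      (Finset.univ.filter fun q : (Fin m → ZMod p) × (Fin m → ZMod p) =>
        P (x + (i : ZMod p) • q.2, q.1)).card ≤ B.card := by
    intro i hi
    refine le_trans (Finset.card_le_card_of_injOn Prod.swap (fun q hq => ?_)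
      Prod.swap_injective.injOn) (hrow i hi)
    simpa using hq
  have hcover : (Finset.univ.filter fun q : (Fin m → ZMod p) × (Fin m → ZMod p) =>
      ¬ F q.1 = F q.2) ⊆
      ((Finset.Icc 1 (d + 1)).biUnion fun i =>
        Finset.univ.filter fun q => P (x + (i : ZMod p) • q.1, q.2)) ∪
      ((Finset.Icc 1 (d + 1)).biUnion fun i =>
        Finset.univ.filter fun q => P (x + (i : ZMod p) • q.2, q.1)) := by
    intro q hq
    by_contra hgood
    simp only [Finset.mem_union, Finset.mem_biUnion, Finset.mem_filter_univ, not_or, not_exists,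
      not_and, P, not_not] at hgood
    exact (Finset.mem_filter_univ _).1 hq
      (sum_Icc_smul_eq_of_grid (by simp [hα]) hgood.1 hgood.2)
  have hbad : (Finset.univ.filter fun q : (Fin m → ZMod p) × (Fin m → ZMod p) =>
      ¬ F q.1 = F q.2).card ≤ (d + 1) * B.card + (d + 1) * B.card := by
    refine (Finset.card_le_card hcover).trans ((Finset.card_union_le _ _).trans (add_le_add ?_ ?_))
    · simpa using Finset.card_biUnion_le_card_mul _ _ _ hrow
    · simpa using Finset.card_biUnion_le_card_mul _ _ _ hcol
  have hgood := card_collision_le_card_mul F (N := N) fun v => by convert hg x v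
  have htotal := Finset.card_filter_add_card_filter_not
    (s := (Finset.univ : Finset ((Fin m → ZMod p) × (Fin m → ZMod p)))) (fun q => F q.1 = F q.2)
  have hcard : Fintype.card (Fin m → ZMod p) = p ^ m := by simp [ZMod.card]
  rw [Finset.card_univ, Fintype.card_prod, hcard] at htotal
  rw [hcard] at hgood
  have hineq : ((p : ℝ) ^ m) * (p : ℝ) ^ m ≤
      (p : ℝ) ^ m * N + ((d + 1) * B.card + (d + 1) * B.card) := by
    exact_mod_cast htotal.symm.le.trans (add_le_add hgood hbad)
  have hpos : (0 : ℝ) < (p : ℝ) ^ m := pow_pos (mod_cast (Fact.out : p.Prime).pos) m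
  have hN : (1 - 2 * ((d : ℝ) + 1) * ρ) * (p : ℝ) ^ m ≤ N := by
    refine le_of_mul_le_mul_left ?_ hpos
    rw [two_mul m, pow_add] at hB
    have hd := mul_le_mul_of_nonneg_left hB (by positivity : (0 : ℝ) ≤ 2 * ((d : ℝ) + 1))
    linarith
  simpa only [N, F, eq_comm] using hN
end

section
/- Let p be a prime, d, m, ℓ natural numbers, and ρ ≥ 0 a real number. For 0 ≤ i ≤ d+1 set α_i = (-1)^{i+1}·C(d+1, i) ∈ ZMod p. Let f : (Fin m → ZMod p) → (Fin ℓ → ZMod p) satisfy: the number of pairs (x, h) with Σ_{i=0}^{d+1} α_i • f(x + i • h) ≠ 0 is at most ρ·p^{2m}. Then for every x ∈ (Fin m → ZMod p), the number of pairs (h₁, h₂) ∈ (Fin m → ZMod p)² with Σ_{i=1}^{d+1} α_i • f(x + i • h₁) = Σ_{j=1}^{d+1} α_j • f(x + j • h₂) is at least (1 − 2(d+1)ρ)·p^{2m}. -/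
/-- Over `ZMod p`, alternating binomial sums of order `n ≥ p` vanish, because
`(1 - X) ^ p = 1 - X ^ p` and translation by `h` has order dividing `p`. -/
lemma sum_neg_one_pow_mul_choose_smul_eq_zero {p : ℕ} [Fact p.Prime] {V W : Type*}
    [AddCommGroup V] [Module (ZMod p) V] [AddCommGroup W] [Module (ZMod p) W]
    {n : ℕ} (hn : p ≤ n) (f : V → W) (x h : V) :
    ∑ i ∈ Finset.range (n + 1),
      ((-1 : ZMod p) ^ (i + 1) * (n.choose i : ZMod p)) • f (x + (i : ZMod p) • h) = 0 := by
  let T : Module.End (ZMod p) (V → W) := LinearMap.funLeft (ZMod p) W (fun y => y + h)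
  have hT : ∀ (g : V → W) (i : ℕ) (y : V), (T ^ i) g y = g (y + (i : ZMod p) • h) := by
    intro g i
    induction i with
    | zero => simp
    | succ i ih =>
      intro y
      rw [pow_succ', Module.End.mul_apply]
      change (T ^ i) g (y + h) = _
      rw [ih]
      congr 1
      push_cast
      module
  have hTp : T ^ p = 1 := by
    refine LinearMap.ext fun g => funext fun y => ?_
    simp [hT]
  have hpoly : Polynomial.aeval T ((1 - Polynomial.X : Polynomial (ZMod p)) ^ n) = 0 := by
    obtain ⟨k, rfl⟩ := Nat.exists_eq_add_of_le hn
    rw [pow_add, sub_pow_char]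
    simp [hTp]
  have hsum : (1 - Polynomial.X : Polynomial (ZMod p)) ^ n =
      ∑ i ∈ Finset.range (n + 1),
        Polynomial.C ((-1 : ZMod p) ^ i * (n.choose i : ZMod p)) * Polynomial.X ^ i := by
    rw [sub_eq_neg_add, add_pow]
    refine Finset.sum_congr rfl fun i _ => ?_
    rw [neg_pow]
    simp only [map_mul, map_pow, map_neg, map_one, map_natCast, one_pow]
    ring
  rw [hsum] at hpoly
  have hval := congrFun (LinearMap.congr_fun hpoly f) x
  simp only [map_sum, map_mul, Polynomial.aeval_C, Polynomial.aeval_X_pow, LinearMap.sum_apply,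
    Finset.sum_apply, Module.End.mul_apply, Module.algebraMap_end_apply, Pi.smul_apply, hT,
    LinearMap.zero_apply, Pi.zero_apply] at hval
  rw [← neg_eq_zero, ← Finset.sum_neg_distrib, ← hval]
  refine Finset.sum_congr rfl fun i _ => ?_
  rw [← neg_smul, pow_succ]
  simp [mul_smul]

/-- If `a 0 = -1` and the relation `∑ a i • f (y + i • h) = 0` holds along the rows and the columns
of the grid `x + i • h₁ + j • h₂` (with `i, j ≥ 1`), then the two boundary sums agree. -/
lemma sum_smul_eq_sum_smul_of_grid {R V W : Type*} [CommRing R] [AddCommGroup V] [Module R V]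
    [AddCommGroup W] [Module R W] {n : ℕ} {a : ℕ → R} (ha : a 0 = -1) {f : V → W} {x h₁ h₂ : V}
    (hrow : ∀ i ∈ Finset.Icc 1 n,
      ∑ j ∈ Finset.range (n + 1), a j • f (x + (i : R) • h₁ + (j : R) • h₂) = 0)
    (hcol : ∀ j ∈ Finset.Icc 1 n,
      ∑ i ∈ Finset.range (n + 1), a i • f (x + (j : R) • h₂ + (i : R) • h₁) = 0) :
    ∑ i ∈ Finset.Icc 1 n, a i • f (x + (i : R) • h₁) =
      ∑ j ∈ Finset.Icc 1 n, a j • f (x + (j : R) • h₂) := by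
  have solve : ∀ y h : V, ∑ j ∈ Finset.range (n + 1), a j • f (y + (j : R) • h) = 0 →
      f y = ∑ j ∈ Finset.Icc 1 n, a j • f (y + (j : R) • h) := by
    intro y h H
    rw [Finset.range_eq_Ico, Finset.sum_eq_sum_Ico_succ_bot (by omega), ha] at H
    simp only [Nat.cast_zero, zero_smul, add_zero, neg_smul, one_smul] at H
    exact neg_add_eq_zero.mp H
  rw [Finset.sum_congr rfl fun i hi => congrArg (a i • ·) (solve _ _ (hrow i hi)),
    Finset.sum_congr rfl fun j hj => congrArg (a j • ·) (solve _ _ (hcol j hj))]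
  simp only [Finset.smul_sum]
  rw [Finset.sum_comm]
  refine Finset.sum_congr rfl fun j _ => Finset.sum_congr rfl fun i _ => ?_
  rw [smul_comm, add_right_comm]

/-- If a pair lies in `S` as soon as it avoids `B` under all the maps `(h₁, h₂) ↦ (x + i • h₁, h₂)` and
`(h₁, h₂) ↦ (x + i • h₂, h₁)`, then a union bound controls the complement of `S`. -/
lemma card_compl_le_of_avoid {K V : Type*} [Field K] [AddCommGroup V] [Module K V] [Fintype V]
    [DecidableEq V] {n : ℕ} (hn : ∀ i ∈ Finset.Icc 1 n, (i : K) ≠ 0) (x : V)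
    (B S : Finset (V × V))
    (hS : ∀ h₁ h₂ : V, (∀ i ∈ Finset.Icc 1 n, (x + (i : K) • h₁, h₂) ∉ B) →
      (∀ i ∈ Finset.Icc 1 n, (x + (i : K) • h₂, h₁) ∉ B) → (h₁, h₂) ∈ S) :
    Sᶜ.card ≤ n * (2 * B.card) := by
  classical
  let row (i : ℕ) : Finset (V × V) := Finset.univ.filter fun h => (x + (i : K) • h.1, h.2) ∈ B
  let col (i : ℕ) : Finset (V × V) := Finset.univ.filter fun h => (x + (i : K) • h.2, h.1) ∈ B
  have hsub : Sᶜ ⊆ (Finset.Icc 1 n).biUnion fun i => row i ∪ col i := by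
    rintro ⟨h₁, h₂⟩ hh
    by_contra hnot
    simp only [Finset.mem_biUnion, Finset.mem_union, row, col, Finset.mem_filter,
      Finset.mem_univ, true_and, not_exists, not_and, not_or] at hnot
    exact Finset.mem_compl.mp hh
      (hS h₁ h₂ (fun i hi => (hnot i hi).1) fun i hi => (hnot i hi).2)
  have hrow : ∀ i ∈ Finset.Icc 1 n, (row i).card ≤ B.card := by
    intro i hi
    refine Finset.card_le_card_of_injOn (fun h => (x + (i : K) • h.1, h.2))
      (fun h hh => (Finset.mem_filter.mp hh).2) ?_
    rintro ⟨u, v⟩ - ⟨u', v'⟩ - huv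
    simpa [smul_right_inj (hn i hi)] using huv
  have hcol : ∀ i ∈ Finset.Icc 1 n, (col i).card ≤ B.card := by
    intro i hi
    refine Finset.card_le_card_of_injOn (fun h => (x + (i : K) • h.2, h.1))
      (fun h hh => (Finset.mem_filter.mp hh).2) ?_
    rintro ⟨u, v⟩ - ⟨u', v'⟩ - huv
    simpa [smul_right_inj (hn i hi), and_comm] using huv
  calc Sᶜ.card ≤ _ := Finset.card_le_card hsub
    _ ≤ (Finset.Icc 1 n).card * (2 * B.card) := by
        refine Finset.card_biUnion_le_card_mul _ _ _ fun i hi => ?_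
        have := Finset.card_union_le (row i) (col i)
        have := hrow i hi
        have := hcol i hi
        omega
    _ = n * (2 * B.card) := by simp


theorem stmt_5 (p : ℕ) [Fact p.Prime] (d m ℓ : ℕ) (ρ : ℝ) (hρ : 0 ≤ ρ)
    (f : (Fin m → ZMod p) → (Fin ℓ → ZMod p))
    (hf : ((Finset.univ.filter fun xh : (Fin m → ZMod p) × (Fin m → ZMod p) =>
        ∑ i ∈ Finset.range (d + 2),
          ((-1 : ZMod p) ^ (i + 1) * ((d + 1).choose i : ZMod p)) •
            f (xh.1 + (i : ZMod p) • xh.2) ≠ 0).card : ℝ) ≤ ρ * (p : ℝ) ^ (2 * m)) :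
    ∀ x : Fin m → ZMod p,
      (1 - 2 * ((d : ℝ) + 1) * ρ) * (p : ℝ) ^ (2 * m) ≤
      ((Finset.univ.filter fun hh : (Fin m → ZMod p) × (Fin m → ZMod p) =>
        ∑ i ∈ Finset.Icc 1 (d + 1),
          ((-1 : ZMod p) ^ (i + 1) * ((d + 1).choose i : ZMod p)) •
            f (x + (i : ZMod p) • hh.1) =
        ∑ j ∈ Finset.Icc 1 (d + 1),
          ((-1 : ZMod p) ^ (j + 1) * ((d + 1).choose j : ZMod p)) •
            f (x + (j : ZMod p) • hh.2)).card : ℝ) := by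
  intro x
  set S := Finset.univ.filter fun hh : (Fin m → ZMod p) × (Fin m → ZMod p) =>
    ∑ i ∈ Finset.Icc 1 (d + 1),
      ((-1 : ZMod p) ^ (i + 1) * ((d + 1).choose i : ZMod p)) • f (x + (i : ZMod p) • hh.1) =
    ∑ j ∈ Finset.Icc 1 (d + 1),
      ((-1 : ZMod p) ^ (j + 1) * ((d + 1).choose j : ZMod p)) • f (x + (j : ZMod p) • hh.2)
    with hS
  set B := Finset.univ.filter fun xh : (Fin m → ZMod p) × (Fin m → ZMod p) =>
    ∑ i ∈ Finset.range (d + 2),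
      ((-1 : ZMod p) ^ (i + 1) * ((d + 1).choose i : ZMod p)) •
        f (xh.1 + (i : ZMod p) • xh.2) ≠ 0 with hB
  have hcompl : Sᶜ.card ≤ (d + 1) * (2 * B.card) := by
    rcases le_or_gt p (d + 1) with hpd | hpd
    · have hsum : ∀ h : Fin m → ZMod p, ∑ i ∈ Finset.Icc 1 (d + 1),
          ((-1 : ZMod p) ^ (i + 1) * ((d + 1).choose i : ZMod p)) •
            f (x + (i : ZMod p) • h) = f x := by
        intro h
        have H := sum_neg_one_pow_mul_choose_smul_eq_zero hpd f x h
        rw [Finset.range_eq_Ico, Finset.sum_eq_sum_Ico_succ_bot (by omega)] at H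
        simp only [zero_add, pow_one, Nat.choose_zero_right, Nat.cast_one, mul_one,
          Nat.cast_zero, zero_smul, add_zero, neg_smul, one_smul] at H
        exact (neg_add_eq_zero.mp H).symm
      have hSuniv : S = Finset.univ := by
        rw [hS]
        exact Finset.filter_true_of_mem fun hh _ => (hsum hh.1).trans (hsum hh.2).symm
      simp [hSuniv]
    · refine card_compl_le_of_avoid (K := ZMod p) ?_ x B S ?_
      · intro i hi hi0
        rw [Finset.mem_Icc] at hi
        have := Nat.le_of_dvd (by omega) ((ZMod.natCast_eq_zero_iff i p).mp hi0)
        omega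
      · intro h₁ h₂ hrow hcol
        simp only [hB, Finset.mem_filter, Finset.mem_univ, true_and, not_not] at hrow hcol
        simp only [hS, Finset.mem_filter, Finset.mem_univ, true_and]
        exact sum_smul_eq_sum_smul_of_grid
          (a := fun i => (-1 : ZMod p) ^ (i + 1) * ((d + 1).choose i : ZMod p))
          (by simp) hrow hcol
  have htotal : (S.card : ℝ) + Sᶜ.card = (p : ℝ) ^ (2 * m) := by
    rw [← Nat.cast_add, Finset.card_add_card_compl]
    simp [ZMod.card, two_mul, pow_add]
  have hcompl' : (Sᶜ.card : ℝ) ≤ ((d : ℝ) + 1) * (2 * B.card) := by exact_mod_cast hcompl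
  have hbound : ((d : ℝ) + 1) * (2 * B.card) ≤ ((d : ℝ) + 1) * (2 * (ρ * (p : ℝ) ^ (2 * m))) := by
    gcongr
  linarith
end

section
/- Let V be a finite vertex type with |V| = n ≥ 1 and let G be a simple graph on V in which every vertex has degree d ≥ 1. Let 0 ≤ λ ≤ 1 be a real number such that the normalized adjacency matrix of G has second eigenvalue at most λ, in the sense that for every x : V → ℝ with Σ_v x(v) = 0 one has Σ_v ((1/d)·Σ_{u : G.Adj v u} x(u))² ≤ λ²·Σ_v x(v)². Let 0 < ε < 1 be real, let B be a finite set of vertices with |B| ≤ ε·n, and let t ≥ 1 be a natural number. Then the number of tuples w : Fin t → V such that w(i) ∈ B for every i, and G.Adj (w i) (w (i+1)) for every i with i+1 < t, is at most n·d^{t−1}·((1−λ)·√ε + λ)^{t−1}. -/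
open Finset

/-- The number of walks with `k` edges confined to `B` that start at a given vertex. -/
def confinedWalkCount {V : Type*} [Fintype V] [DecidableEq V] (G : SimpleGraph V)
    [DecidableRel G.Adj] (B : Finset V) : ℕ → V → ℝ
  | 0, v => if v ∈ B then 1 else 0
  | k + 1, v => if v ∈ B then ∑ u ∈ G.neighborFinset v, confinedWalkCount G B k u else 0

section Walks

variable {V : Type*} [Fintype V] (G : SimpleGraph V) [DecidableRel G.Adj]

lemma confinedWalkCount_eq_zero [DecidableEq V] (B : Finset V) (k : ℕ) {v : V} (hv : v ∉ B) :
    confinedWalkCount G B k v = 0 := by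
  cases k <;> simp [confinedWalkCount, hv]

lemma sum_walks_confined [DecidableEq V] (B : Finset V) (k : ℕ) (g : V → ℝ) :
    (∑ w : Fin (k + 1) → V,
      if (∀ i, w i ∈ B) ∧ ∀ i : Fin k, G.Adj (w i.castSucc) (w i.succ) then g (w 0) else 0) =
      ∑ v, g v * confinedWalkCount G B k v := by
  induction k generalizing g with
  | zero =>
    rw [← (Equiv.funUnique (Fin 1) V).symm.sum_comp]
    simp [confinedWalkCount]
  | succ k ih =>
    rw [← (Fin.consEquiv fun _ : Fin (k + 2) => V).sum_comp, Fintype.sum_prod_type]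
    refine sum_congr rfl fun v _ => ?_
    have h := ih fun u => if v ∈ B ∧ G.Adj v u then g v else 0
    have hr : g v * confinedWalkCount G B (k + 1) v =
        ∑ u, (if v ∈ B ∧ G.Adj v u then g v else 0) * confinedWalkCount G B k u := by
      by_cases hv : v ∈ B
      · simp [confinedWalkCount, hv, SimpleGraph.neighborFinset_eq_filter, mul_sum, sum_filter]
      · simp [confinedWalkCount, hv]
    rw [hr, ← h]
    refine sum_congr rfl fun w _ => ?_
    rw [← ite_and]
    refine if_congr ?_ (by simp [Fin.consEquiv]) rfl
    simp only [Fin.consEquiv, Equiv.coe_fn_mk, Fin.forall_fin_succ (n := k + 1),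
      Fin.forall_fin_succ (n := k), Fin.cons_zero, Fin.cons_succ, Fin.castSucc_zero,
      ← Fin.succ_castSucc]
    tauto

lemma card_walks_confined [DecidableEq V] (B : Finset V) (k : ℕ) :
    (Nat.card {w : Fin (k + 1) → V // (∀ i, w i ∈ B) ∧
      ∀ i : Fin (k + 1), ∀ hi : (i : ℕ) + 1 < k + 1, G.Adj (w i) (w ⟨(i : ℕ) + 1, hi⟩)} : ℝ) =
      ∑ v, confinedWalkCount G B k v := by
  have h := sum_walks_confined G B k fun _ => 1
  simp only [one_mul] at h
  rw [← h, Nat.card_eq_fintype_card, Fintype.card_subtype, sum_boole]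
  congr 3
  ext w
  refine and_congr_right fun _ => ⟨fun h i => ?_, fun h i hi => ?_⟩
  · exact h i.castSucc (by simp)
  · exact h ⟨i, by omega⟩

lemma sum_sum_neighborFinset {d : ℕ} (hreg : ∀ v, G.degree v = d) (x : V → ℝ) :
    ∑ v, ∑ u ∈ G.neighborFinset v, x u = d * ∑ v, x v := by
  simp only [SimpleGraph.neighborFinset_eq_filter, sum_filter]
  rw [sum_comm, mul_sum]
  refine sum_congr rfl fun u _ => ?_
  simp_rw [G.adj_comm _ u]
  rw [← sum_filter, ← SimpleGraph.neighborFinset_eq_filter, sum_const,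
    G.card_neighborFinset_eq_degree, hreg, nsmul_eq_mul]

/-- In a regular spectral expander, the adjacency operator contracts functions supported on a
set of density at most `ε`. -/
lemma sum_sq_sum_neighborFinset_le {d : ℕ} (hd : 1 ≤ d) (hreg : ∀ v, G.degree v = d)
    (hV : 1 ≤ Fintype.card V) {lam : ℝ} (hlam0 : 0 ≤ lam) (hlam1 : lam ≤ 1)
    (hexp : ∀ x : V → ℝ, (∑ v, x v) = 0 →
      ∑ v, ((1 / (d : ℝ)) * ∑ u ∈ G.neighborFinset v, x u) ^ 2 ≤ lam ^ 2 * ∑ v, (x v) ^ 2)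
    {ε : ℝ} (hε0 : 0 < ε) (hε1 : ε < 1) {B : Finset V}
    (hB : (B.card : ℝ) ≤ ε * Fintype.card V) {f : V → ℝ} (hf : ∀ v ∉ B, f v = 0) :
    ∑ v, (∑ u ∈ G.neighborFinset v, f u) ^ 2 ≤
      (d * ((1 - lam) * Real.sqrt ε + lam)) ^ 2 * ∑ v, f v ^ 2 := by
  have hn : (0 : ℝ) < Fintype.card V := by exact_mod_cast hV
  set n : ℝ := ((Fintype.card V : ℕ) : ℝ) with hn_def
  set S := ∑ v, f v with hS
  set Q := ∑ v, f v ^ 2 with hQ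
  set c := S / n with hc
  have hcn : n * c = S := by rw [hc]; field_simp
  have hQ0 : 0 ≤ Q := sum_nonneg fun _ _ => sq_nonneg _
  have hg : ∑ v, (f v - c) = 0 := by
    simp [sum_sub_distrib, ← hS, ← hn_def, hcn]
  have hgQ : ∑ v, (f v - c) ^ 2 = Q - n * c ^ 2 := by
    simp only [sub_sq, sum_add_distrib, sum_sub_distrib, ← sum_mul, ← mul_sum, ← hS, ← hQ,
      sum_const, card_univ, nsmul_eq_mul, ← hn_def]
    rw [← hcn]; ring
  have hmean : n * c ^ 2 ≤ ε * Q := by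
    have hsupp : S ^ 2 ≤ B.card * Q := by
      have h1 : S = ∑ v ∈ B, f v :=
        (sum_subset (subset_univ B) fun v _ hv => hf v hv).symm
      have h2 : ∑ v ∈ B, f v ^ 2 ≤ Q :=
        sum_le_sum_of_subset_of_nonneg (subset_univ B) fun _ _ _ => sq_nonneg _
      rw [h1]
      exact sq_sum_le_card_mul_sum_sq.trans (by gcongr)
    have h3 : S ^ 2 ≤ ε * n * Q := hsupp.trans (by gcongr)
    rw [← hcn] at h3
    refine le_of_mul_le_mul_left ?_ hn
    linarith
  set A : V → ℝ := fun v => 1 / (d : ℝ) * ∑ u ∈ G.neighborFinset v, (f u - c) with hA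
  have hAf : ∀ v, ∑ u ∈ G.neighborFinset v, f u = d * (A v + c) := by
    intro v
    simp only [hA, sum_sub_distrib, sum_const, G.card_neighborFinset_eq_degree, hreg, nsmul_eq_mul]
    field_simp
    ring
  have hA0 : ∑ v, A v = 0 := by
    simp only [hA, ← mul_sum]
    rw [sum_sum_neighborFinset G hreg, hg]
    simp
  have hA2 : ∑ v, A v ^ 2 ≤ lam ^ 2 * (Q - n * c ^ 2) := hgQ ▸ hexp _ hg
  have hsum : ∑ v, (∑ u ∈ G.neighborFinset v, f u) ^ 2 =
      (d : ℝ) ^ 2 * (∑ v, A v ^ 2 + n * c ^ 2) := by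
    simp only [hAf, mul_pow, ← mul_sum, add_sq, sum_add_distrib, ← sum_mul, hA0, sum_const,
      card_univ, nsmul_eq_mul, ← hn_def]
    ring
  rw [hsum, mul_pow, mul_assoc]
  gcongr
  have hs0 := Real.sqrt_nonneg ε
  have hs : Real.sqrt ε ^ 2 = ε := Real.sq_sqrt hε0.le
  have hs1 : ε ≤ Real.sqrt ε := Real.le_sqrt_of_sq_le (by nlinarith)
  have hcoef : (1 - lam ^ 2) * ε + lam ^ 2 ≤ ((1 - lam) * Real.sqrt ε + lam) ^ 2 := by
    have h : 0 ≤ 2 * (lam * (1 - lam)) * (Real.sqrt ε - ε) := by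
      have := sub_nonneg.2 hlam1
      have := sub_nonneg.2 hs1
      positivity
    linear_combination h - (1 - lam) ^ 2 * hs
  have hlam2 : 0 ≤ 1 - lam ^ 2 := by nlinarith
  calc ∑ v, A v ^ 2 + n * c ^ 2 ≤ (1 - lam ^ 2) * (n * c ^ 2) + lam ^ 2 * Q := by linarith
    _ ≤ (1 - lam ^ 2) * (ε * Q) + lam ^ 2 * Q := by gcongr
    _ = ((1 - lam ^ 2) * ε + lam ^ 2) * Q := by ring
    _ ≤ _ := by gcongr

end Walks

theorem stmt_7 {V : Type*} [Fintype V] [DecidableEq V] (G : SimpleGraph V) [DecidableRel G.Adj]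
    (n d : ℕ) (hn : Fintype.card V = n) (hn1 : 1 ≤ n) (hd : 1 ≤ d)
    (hreg : ∀ v : V, G.degree v = d)
    (lam : ℝ) (hlam0 : 0 ≤ lam) (hlam1 : lam ≤ 1)
    (hexp : ∀ x : V → ℝ, (∑ v, x v) = 0 →
      ∑ v, ((1 / (d : ℝ)) * ∑ u ∈ G.neighborFinset v, x u) ^ 2 ≤
        lam ^ 2 * ∑ v, (x v) ^ 2)
    (ε : ℝ) (hε0 : 0 < ε) (hε1 : ε < 1)
    (B : Finset V) (hB : (B.card : ℝ) ≤ ε * n)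
    (t : ℕ) (ht : 1 ≤ t) :
    (Nat.card {w : Fin t → V // (∀ i : Fin t, w i ∈ B) ∧
        ∀ i : Fin t, ∀ hi : (i : ℕ) + 1 < t, G.Adj (w i) (w ⟨(i : ℕ) + 1, hi⟩)} : ℝ) ≤
      (n : ℝ) * (d : ℝ) ^ (t - 1) * ((1 - lam) * Real.sqrt ε + lam) ^ (t - 1) := by
  subst hn
  obtain ⟨k, rfl⟩ : ∃ k, t = k + 1 := ⟨t - 1, by omega⟩
  rw [card_walks_confined, Nat.add_sub_cancel, mul_assoc, ← mul_pow]
  set r : ℝ := d * ((1 - lam) * Real.sqrt ε + lam) with hr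
  have hr0 : 0 ≤ r := by
    have := sub_nonneg.2 hlam1
    positivity
  have hnorm : ∀ j, ∑ v, confinedWalkCount G B j v ^ 2 ≤ (r ^ j) ^ 2 * B.card := by
    intro j
    induction j with
    | zero => simp [confinedWalkCount]
    | succ j ih =>
      calc ∑ v, confinedWalkCount G B (j + 1) v ^ 2
          ≤ ∑ v, (∑ u ∈ G.neighborFinset v, confinedWalkCount G B j u) ^ 2 := by
            refine sum_le_sum fun v _ => ?_
            rw [confinedWalkCount]
            split_ifs
            · rfl
            · simpa using sq_nonneg _
        _ ≤ r ^ 2 * ∑ v, confinedWalkCount G B j v ^ 2 :=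
            sum_sq_sum_neighborFinset_le G hd hreg hn1 hlam0 hlam1 hexp hε0 hε1 hB
              fun v hv => confinedWalkCount_eq_zero G B j hv
        _ ≤ r ^ 2 * ((r ^ j) ^ 2 * B.card) := by gcongr
        _ = (r ^ (j + 1)) ^ 2 * B.card := by ring
  refine abs_le_of_sq_le_sq' ?_ (by positivity) |>.2
  calc (∑ v, confinedWalkCount G B k v) ^ 2
      ≤ Fintype.card V * ∑ v, confinedWalkCount G B k v ^ 2 := sq_sum_le_card_mul_sum_sq
    _ ≤ Fintype.card V * ((r ^ k) ^ 2 * Fintype.card V) := by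
        gcongr
        exact (hnorm k).trans (by gcongr; exact card_le_univ B)
    _ = (Fintype.card V * r ^ k) ^ 2 := by ring
end

section
/- Let m, k, r, ℓ be natural numbers with 1 ≤ r ≤ k, and let ε be a real number with 0 < ε < 1. Suppose ℓ = ⌈3m/(ε·r)⌉ and log k ≤ m/r (natural logarithm, real division). Call a tuple I : Fin k → Finset (Fin m) with |I(i)| = ℓ for all i a failing tuple if there exists S : Finset (Fin k) with |S| = r such that |⋃_{i ∈ S} I(i)| < (1 − ε)·m. Then the number of failing tuples is at most e^{−m}·C(m, ℓ)^k. (Equivalently, if I(1), …, I(k) are independently uniformly random ℓ-subsets of an m-element set, then with probability at least 1 − e^{−m}, the union of every r of them has size at least (1 − ε)·m, i.e., they form an (m, k, ℓ, r, ε)-disperser.) -/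
theorem Nat.descFactorial_mul_pow_le {t m : ℕ} (h : t ≤ m) (l : ℕ) :
    t.descFactorial l * m ^ l ≤ m.descFactorial l * t ^ l := by
  induction l with
  | zero => simp
  | succ l ih =>
    have hstep : (t - l) * m ≤ (m - l) * t := by
      rw [Nat.sub_mul, Nat.sub_mul, Nat.mul_comm t m]
      exact Nat.sub_le_sub_left (Nat.mul_le_mul_left l h) _
    calc t.descFactorial (l + 1) * m ^ (l + 1)
        = ((t - l) * m) * (t.descFactorial l * m ^ l) := by
          rw [Nat.descFactorial_succ]; ring
      _ ≤ ((m - l) * t) * (m.descFactorial l * t ^ l) := Nat.mul_le_mul hstep ih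
      _ = m.descFactorial (l + 1) * t ^ (l + 1) := by
          rw [Nat.descFactorial_succ]; ring

theorem Nat.choose_mul_pow_le {t m : ℕ} (h : t ≤ m) (l : ℕ) :
    t.choose l * m ^ l ≤ m.choose l * t ^ l := by
  have key := Nat.descFactorial_mul_pow_le h l
  rw [Nat.descFactorial_eq_factorial_mul_choose, Nat.descFactorial_eq_factorial_mul_choose,
    mul_assoc, mul_assoc] at key
  exact Nat.le_of_mul_le_mul_left key l.factorial_pos

theorem Nat.choose_le_exp_mul_choose {t m : ℕ} {ε : ℝ} (hε : 0 ≤ ε)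
    (h : (t : ℝ) < (1 - ε) * m) (l : ℕ) :
    (t.choose l : ℝ) ≤ Real.exp (-(ε * l)) * m.choose l := by
  have hm0 : (0 : ℝ) ≤ m := m.cast_nonneg
  have ht0 : (0 : ℝ) ≤ t := t.cast_nonneg
  have htm : (t : ℝ) < m := by nlinarith
  have hm : (0 : ℝ) < m := ht0.trans_lt htm
  have key : (t.choose l : ℝ) * (m : ℝ) ^ l ≤ m.choose l * (t : ℝ) ^ l := by
    exact_mod_cast Nat.choose_mul_pow_le (Nat.cast_lt.mp htm).le l
  have hexp : (t : ℝ) ≤ Real.exp (-ε) * m := by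
    have := Real.add_one_le_exp (-ε)
    nlinarith
  have hpow : (t : ℝ) ^ l ≤ Real.exp (-(ε * l)) * (m : ℝ) ^ l := by
    calc (t : ℝ) ^ l ≤ (Real.exp (-ε) * m) ^ l := pow_le_pow_left₀ ht0 hexp l
      _ = Real.exp (-(ε * l)) * (m : ℝ) ^ l := by
        rw [mul_pow, ← Real.exp_nat_mul]; congr 2; ring
  refine le_of_mul_le_mul_right ?_ (pow_pos hm l)
  calc (t.choose l : ℝ) * (m : ℝ) ^ l ≤ m.choose l * (t : ℝ) ^ l := key
    _ ≤ m.choose l * (Real.exp (-(ε * l)) * (m : ℝ) ^ l) := by gcongr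
    _ = Real.exp (-(ε * l)) * m.choose l * (m : ℝ) ^ l := by ring

/-- The tuples of `l`-subsets of `α` whose members with index in `S` are contained in `T`. -/
def Finset.confinedTuples {ι α : Type*} [Fintype ι] [DecidableEq ι] [Fintype α]
    (l : ℕ) (S : Finset ι) (T : Finset α) : Finset (ι → Finset α) :=
  Fintype.piFinset fun i => if i ∈ S then T.powersetCard l else Finset.univ.powersetCard l

theorem Finset.card_confinedTuples {ι α : Type*} [Fintype ι] [DecidableEq ι] [Fintype α]
    (l : ℕ) (S : Finset ι) (T : Finset α) :
    (Finset.confinedTuples l S T).card =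
      T.card.choose l ^ S.card * (Fintype.card α).choose l ^ (Fintype.card ι - S.card) := by
  simp only [confinedTuples, Fintype.card_piFinset, apply_ite Finset.card, card_powersetCard,
    card_univ, prod_ite, prod_const]
  rw [filter_mem_eq_inter, univ_inter, filter_not, filter_mem_eq_inter, univ_inter,
    card_sdiff_of_subset (subset_univ S), card_univ]

theorem stmt_8 (m k r ℓ : ℕ) (hr1 : 1 ≤ r) (hrk : r ≤ k)
    (ε : ℝ) (hε0 : 0 < ε) (hε1 : ε < 1)
    (hℓ : ℓ = ⌈(3 * (m : ℝ)) / (ε * r)⌉₊)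
    (hlog : Real.log k ≤ (m : ℝ) / r) :
    (Nat.card {I : Fin k → Finset (Fin m) //
        (∀ i : Fin k, (I i).card = ℓ) ∧
        ∃ S : Finset (Fin k), S.card = r ∧ ((S.biUnion I).card : ℝ) < (1 - ε) * m} : ℝ) ≤
      Real.exp (-(m : ℝ)) * ((m.choose ℓ : ℝ)) ^ k := by
  classical
  have hr : (0 : ℝ) < r := by exact_mod_cast hr1
  have hk : (0 : ℝ) < k := by exact_mod_cast hr1.trans hrk
  have hεℓ : 3 * (m : ℝ) ≤ ε * ℓ * r := by
    have := Nat.le_ceil ((3 * (m : ℝ)) / (ε * r))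
    rw [← hℓ, div_le_iff₀ (by positivity)] at this
    linarith
  set P : Finset (Finset (Fin k) × Finset (Fin m)) := Finset.univ.powersetCard r ×ˢ
    Finset.univ.filter fun T : Finset (Fin m) => (T.card : ℝ) < (1 - ε) * m with hP
  have hcount : Nat.card {I : Fin k → Finset (Fin m) //
        (∀ i : Fin k, (I i).card = ℓ) ∧
        ∃ S : Finset (Fin k), S.card = r ∧ ((S.biUnion I).card : ℝ) < (1 - ε) * m} ≤
      ∑ p ∈ P, (Finset.confinedTuples ℓ p.1 p.2).card := by
    rw [Nat.card_eq_fintype_card, Fintype.card_subtype]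
    refine (Finset.card_le_card ?_).trans Finset.card_biUnion_le
    intro I hI
    obtain ⟨hcard, S, hS, hlt⟩ := (Finset.mem_filter.mp hI).2
    refine Finset.mem_biUnion.mpr ⟨(S, S.biUnion I), by simp [hP, hS, hlt], ?_⟩
    refine Fintype.mem_piFinset.mpr fun i => ?_
    split_ifs with hi
    · exact Finset.mem_powersetCard.mpr ⟨Finset.subset_biUnion_of_mem I hi, hcard i⟩
    · exact Finset.mem_powersetCard.mpr ⟨Finset.subset_univ _, hcard i⟩
  have hterm : ∀ p ∈ P, ((Finset.confinedTuples ℓ p.1 p.2).card : ℝ) ≤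
      Real.exp (-(3 * m)) * (m.choose ℓ : ℝ) ^ k := by
    rintro ⟨S, T⟩ hp
    obtain ⟨hS, hT⟩ : S.card = r ∧ (T.card : ℝ) < (1 - ε) * m := by simpa [hP] using hp
    rw [Finset.card_confinedTuples, hS, Fintype.card_fin, Fintype.card_fin]
    push_cast
    calc (T.card.choose ℓ : ℝ) ^ r * (m.choose ℓ : ℝ) ^ (k - r)
        ≤ (Real.exp (-(ε * ℓ)) * m.choose ℓ) ^ r * (m.choose ℓ : ℝ) ^ (k - r) := by
          gcongr
          exact Nat.choose_le_exp_mul_choose hε0.le hT ℓ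
      _ = Real.exp (-(ε * ℓ * r)) * (m.choose ℓ : ℝ) ^ k := by
          rw [mul_pow, mul_assoc, ← pow_add, Nat.add_sub_cancel' hrk, ← Real.exp_nat_mul]
          congr 2; ring
      _ ≤ Real.exp (-(3 * m)) * (m.choose ℓ : ℝ) ^ k := by gcongr
  have hPcard : (P.card : ℝ) ≤ Real.exp m * Real.exp m := by
    have hsubsets : (k.choose r : ℝ) ≤ Real.exp m := by
      calc (k.choose r : ℝ) ≤ (k : ℝ) ^ r := by exact_mod_cast Nat.choose_le_pow k r
        _ = Real.exp (r * Real.log k) := by rw [Real.exp_nat_mul, Real.exp_log hk]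
        _ ≤ Real.exp m := by
          rw [le_div_iff₀ hr] at hlog
          gcongr
          linarith
    have htwo : (2 : ℝ) ^ m ≤ Real.exp m := by
      rw [← Real.exp_one_pow]
      gcongr
      linarith [Real.add_one_le_exp 1]
    have hle : P.card ≤ k.choose r * 2 ^ m := by
      rw [hP, Finset.card_product, Finset.card_powersetCard, Finset.card_univ, Fintype.card_fin]
      gcongr
      exact (Finset.card_filter_le _ _).trans (by simp)
    calc (P.card : ℝ) ≤ k.choose r * 2 ^ m := by exact_mod_cast hle
      _ ≤ Real.exp m * Real.exp m := by gcongr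
  calc _ ≤ ∑ p ∈ P, ((Finset.confinedTuples ℓ p.1 p.2).card : ℝ) := by exact_mod_cast hcount
    _ ≤ P.card * (Real.exp (-(3 * m)) * (m.choose ℓ : ℝ) ^ k) := by
        simpa using Finset.sum_le_card_nsmul P _ _ hterm
    _ ≤ Real.exp m * Real.exp m * (Real.exp (-(3 * m)) * (m.choose ℓ : ℝ) ^ k) := by gcongr
    _ = Real.exp (-(m : ℝ)) * (m.choose ℓ : ℝ) ^ k := by
        rw [← mul_assoc, ← Real.exp_add, ← Real.exp_add]
        congr 2; ring
end

section
/- (Kővári–Sós–Turán) Let G be a simple graph on a finite vertex type V with |V| = n, and let a ≥ 2 be a natural number. Suppose G does not contain K_{a,a} as a subgraph, i.e., there do not exist disjoint finite sets S, T of vertices with |S| = |T| = a such that every s ∈ S is adjacent to every t ∈ T. Then the number of edges of G is at most (1/2)·(a−1)^{1/a}·n^{2−1/a} + (1/2)·(a−1)·n. -/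
open Finset in
/-- If no `a + 1` vertices have `a + 1` common neighbours, double counting the pairs formed by a
vertex and an `(a + 1)`-set of its neighbours bounds the sum of the binomials of the degrees. -/
theorem SimpleGraph.sum_choose_degree_le {V : Type*} [Fintype V] (G : SimpleGraph V)
    [DecidableRel G.Adj] (a : ℕ)
    (hfree : ¬ ∃ S T : Finset V, Disjoint S T ∧ S.card = a + 1 ∧ T.card = a + 1 ∧
      ∀ s ∈ S, ∀ t ∈ T, G.Adj s t) :
    ∑ v, (G.degree v).choose (a + 1) ≤ a * (Fintype.card V).choose (a + 1) := by
  classical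
  have hcount := sum_card_bipartiteAbove_eq_sum_card_bipartiteBelow
    (s := (univ : Finset V)) (t := powersetCard (a + 1) (univ : Finset V))
    (fun v S => S ⊆ G.neighborFinset v)
  have hleft (v : V) : #(bipartiteAbove (fun v S => S ⊆ G.neighborFinset v)
      (powersetCard (a + 1) univ) v) = (G.degree v).choose (a + 1) := by
    rw [← G.card_neighborFinset_eq_degree, ← card_powersetCard]
    congr 1
    ext S
    simp [bipartiteAbove, mem_powersetCard, and_comm]
  have hright : ∀ S ∈ powersetCard (a + 1) (univ : Finset V),
      #(bipartiteBelow (fun v S => S ⊆ G.neighborFinset v) univ S) ≤ a := by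
    intro S hS
    by_contra! hlt
    obtain ⟨T, hT, hTcard⟩ := exists_subset_card_eq (Nat.succ_le_of_lt hlt)
    have hadj : ∀ s ∈ S, ∀ t ∈ T, G.Adj s t := fun s hs t ht =>
      ((G.mem_neighborFinset t s).1 (((mem_bipartiteBelow _).1 (hT ht)).2 hs)).symm
    refine hfree ⟨S, T, ?_, (mem_powersetCard.1 hS).2, hTcard, hadj⟩
    exact Finset.disjoint_left.2 fun _ hv hv' => G.irrefl (hadj _ hv _ hv')
  simp_rw [hleft] at hcount
  rw [hcount]
  refine (sum_le_card_nsmul _ _ _ hright).trans_eq ?_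
  rw [card_powersetCard, card_univ, smul_eq_mul, mul_comm]

open Finset in
theorem SimpleGraph.sum_degree_sub_pow_le {V : Type*} [Fintype V] (G : SimpleGraph V)
    [DecidableRel G.Adj] (a : ℕ)
    (hfree : ¬ ∃ S T : Finset V, Disjoint S T ∧ S.card = a + 1 ∧ T.card = a + 1 ∧
      ∀ s ∈ S, ∀ t ∈ T, G.Adj s t) :
    ∑ v, (G.degree v - a) ^ (a + 1) ≤ a * Fintype.card V ^ (a + 1) :=
  calc
    ∑ v, (G.degree v - a) ^ (a + 1) ≤ ∑ v, (G.degree v).descFactorial (a + 1) :=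
      sum_le_sum fun v _ => by
        simpa using Nat.pow_sub_le_descFactorial (G.degree v) (a + 1)
    _ = (a + 1).factorial * ∑ v, (G.degree v).choose (a + 1) := by
      simp_rw [Nat.descFactorial_eq_factorial_mul_choose, mul_sum]
    _ ≤ (a + 1).factorial * (a * (Fintype.card V).choose (a + 1)) :=
      Nat.mul_le_mul_left _ (G.sum_choose_degree_le a hfree)
    _ = a * (Fintype.card V).descFactorial (a + 1) := by
      rw [Nat.descFactorial_eq_factorial_mul_choose, mul_left_comm]
    _ ≤ a * Fintype.card V ^ (a + 1) :=
      Nat.mul_le_mul_left _ (Nat.descFactorial_le_pow _ _)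

/-- A root form of the power mean inequality. -/
theorem Finset.sum_le_rpow_mul_rpow_of_sum_pow_le {ι : Type*} (s : Finset ι) (f : ι → ℝ) (a : ℕ)
    (c : ℝ) (hf : ∀ i ∈ s, 0 ≤ f i) (hc : 0 ≤ c) (hs : s.Nonempty)
    (h : ∑ i ∈ s, f i ^ (a + 1) ≤ c * (s.card : ℝ) ^ (a + 1)) :
    ∑ i ∈ s, f i ≤ c ^ ((1 : ℝ) / (a + 1 : ℕ)) *
      (s.card : ℝ) ^ ((2 : ℝ) - 1 / (a + 1 : ℕ)) := by
  have hpos : (0 : ℝ) < s.card := by exact_mod_cast hs.card_pos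
  have hmean := (pow_sum_div_card_le_sum_pow hf a).trans h
  rw [div_le_iff₀ (by positivity)] at hmean
  refine le_of_pow_le_pow_left₀ a.succ_ne_zero (by positivity) (hmean.trans_eq ?_)
  rw [mul_pow, ← Real.rpow_mul_natCast hc, ← Real.rpow_mul_natCast hpos.le,
    one_div_mul_cancel (by positivity), Real.rpow_one, sub_mul,
    one_div_mul_cancel (by positivity), mul_assoc, ← pow_add, ← Real.rpow_natCast]
  congr 2
  push_cast
  ring

theorem stmt_9 {V : Type*} [Fintype V] (G : SimpleGraph V) [DecidableRel G.Adj]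
    (n a : ℕ) (hn : Fintype.card V = n) (ha : 2 ≤ a)
    (hfree : ¬ ∃ S T : Finset V, Disjoint S T ∧ S.card = a ∧ T.card = a ∧
      ∀ s ∈ S, ∀ t ∈ T, G.Adj s t) :
    (G.edgeFinset.card : ℝ) ≤
      (1 / 2) * ((a : ℝ) - 1) ^ ((1 : ℝ) / a) * (n : ℝ) ^ ((2 : ℝ) - 1 / a) +
        (1 / 2) * ((a : ℝ) - 1) * n := by
  obtain ⟨b, rfl⟩ : ∃ b, a = b + 1 := ⟨a - 1, by omega⟩
  subst hn
  have hb : ((b + 1 : ℕ) : ℝ) - 1 = b := by push_cast; ring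
  rw [hb]
  have htwice : ∑ v, (G.degree v : ℝ) = 2 * G.edgeFinset.card := by
    exact_mod_cast G.sum_degrees_eq_twice_card_edges
  rcases isEmpty_or_nonempty V with hV | hV
  · rw [Finset.univ_eq_empty, Finset.sum_empty] at htwice
    have : (G.edgeFinset.card : ℝ) = 0 := by linarith
    rw [this]
    positivity
  have hpow : ∑ v, ((G.degree v - b : ℕ) : ℝ) ^ (b + 1) ≤
      b * ((Finset.univ : Finset V).card : ℝ) ^ (b + 1) := by
    exact_mod_cast G.sum_degree_sub_pow_le b hfree
  have hsum := Finset.univ.sum_le_rpow_mul_rpow_of_sum_pow_le _ b b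
    (fun v _ => Nat.cast_nonneg _) b.cast_nonneg Finset.univ_nonempty hpow
  have hdeg : ∑ v, (G.degree v : ℝ) ≤
      ∑ v, ((G.degree v - b : ℕ) : ℝ) + Fintype.card V * b := by
    have : ∑ v, (G.degree v : ℝ) ≤ ∑ v, (((G.degree v - b : ℕ) : ℝ) + b) :=
      Finset.sum_le_sum fun v _ => by exact_mod_cast le_tsub_add
    simpa [Finset.sum_add_distrib] using this
  rw [Finset.card_univ] at hsum
  linarith
end

section
/- Let k, d, ℓ, n be natural numbers with k ≥ 1, and let V : Fin k → Finset (Fin d → ZMod 5) with n = Σ_{g} |V(g)|. Assume: (a) for every g and all distinct u, v ∈ V(g) and every a ∈ ZMod 5 with a ≠ 0, u ≠ a • v; (b) for every g and all pairwise distinct u, v, w ∈ V(g) and every a ∈ ZMod 5 with a ≠ 0, u − w ≠ a • (w − v); and the size conditions (c) 4·5^d ≤ 5^{k·ℓ} and (d) 4·n³·5^{2k} ≤ 5^ℓ. Then there exist matrices A₁, …, A_ℓ ∈ (ZMod 5)^{k×d} such that, defining f(α, v) = (⟨α, A₁ v⟩, …, ⟨α, A_ℓ v⟩) ∈ (Fin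 ℓ → ZMod 5) for α ∈ (Fin k → ZMod 5) and v ∈ (Fin d → ZMod 5): (1) for every nonzero v ∈ (Fin d → ZMod 5) there exists j with A_j v ≠ 0; (2) for every g, all distinct u, v ∈ V(g), and every nonzero α ∈ (Fin k → ZMod 5), f(α, u) ≠ f(α, v); (3) for every g, all pairwise distinct u, v, w ∈ V(g), and all α, α' ∈ (Fin k → ZMod 5) not both zero, f(α, u) + f(α', v) ≠ f(α + α', w). -/
open Matrix

/-- Union bound for the kernels of a family of surjective homomorphisms of finite groups. -/
lemma card_exists_map_eq_zero_mul_card_le {ι E F : Type*} [AddCommGroup E] [Fintype E]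
    [AddCommGroup F] [Fintype F] [DecidableEq E] [DecidableEq F] (s : Finset ι)
    (T : ι → E →+ F) (hT : ∀ i ∈ s, Function.Surjective (T i)) :
    (Finset.univ.filter fun x => ∃ i ∈ s, T i x = 0).card * Fintype.card F ≤
      s.card * Fintype.card E := by
  have card_ker : ∀ i ∈ s,
      (Finset.univ.filter fun x => T i x = 0).card * Fintype.card F = Fintype.card E := by
    intro i hi
    have h := (T i).ker.card_eq_card_quotient_mul_card_addSubgroup
    rw [Nat.card_congr (QuotientAddGroup.quotientKerEquivOfSurjective (T i) (hT i hi)).toEquiv,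
      Nat.card_eq_fintype_card, Nat.card_eq_fintype_card] at h
    rw [h, mul_comm, ← Fintype.card_subtype,
      ← Nat.card_eq_fintype_card (α := {x // T i x = 0})]
    rfl
  have union : (Finset.univ.filter fun x => ∃ i ∈ s, T i x = 0) =
      s.biUnion fun i => Finset.univ.filter fun x => T i x = 0 := by
    ext x
    simp
  rw [union]
  calc _ ≤ (∑ i ∈ s, (Finset.univ.filter fun x => T i x = 0).card) * Fintype.card F :=
        Nat.mul_le_mul_right _ Finset.card_biUnion_le
    _ = s.card * Fintype.card E := by
        rw [Finset.sum_mul, Finset.sum_congr rfl card_ker, Finset.sum_const, smul_eq_mul]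

section
variable {K m n ι : Type*} [Field K]

lemma exists_tensor_add_ne_zero {α β : m → K} {x y : n → K} (hx : x ≠ 0) (hy : y ≠ 0)
    (hxy : ∀ a : K, a ≠ 0 → x ≠ a • y) (hαβ : ¬(α = 0 ∧ β = 0)) :
    ∃ r c, α r * x c + β r * y c ≠ 0 := by
  by_contra! h
  have hα : α = 0 := by
    by_contra hα
    obtain ⟨r, hr⟩ := Function.ne_iff.mp hα
    have hr' : α r ≠ 0 := hr
    have e : x = (-β r / α r) • y := by
      ext c
      have := h r c
      simp only [Pi.smul_apply, smul_eq_mul]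
      field_simp
      linear_combination this
    by_cases hb : β r = 0
    · exact hx (by simpa [hb] using e)
    · exact hxy _ (div_ne_zero (neg_ne_zero.mpr hb) hr') e
  subst hα
  obtain ⟨r, hr⟩ := Function.ne_iff.mp fun hβ : β = 0 => hαβ ⟨rfl, hβ⟩
  obtain ⟨c, hc⟩ := Function.ne_iff.mp hy
  exact mul_ne_zero hr hc (by simpa using h r c)

variable [Fintype n]

/-- Apply each matrix of a family to a fixed vector. -/
def mulVecFamilyHom (v : n → K) : (ι → Matrix m n K) →+ (ι → m → K) where
  toFun A i := A i *ᵥ v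
  map_zero' := by ext; simp
  map_add' A B := by ext; simp [add_mulVec]

lemma mulVecFamilyHom_surjective [DecidableEq n] {v : n → K} (hv : v ≠ 0) :
    Function.Surjective (mulVecFamilyHom (m := m) (ι := ι) v) := by
  obtain ⟨j, hj⟩ := Function.ne_iff.mp hv
  intro y
  refine ⟨fun i => vecMulVec (y i) (Pi.single j (v j)⁻¹), ?_⟩
  funext i
  have hj' : v j ≠ 0 := hj
  ext r
  simp [mulVecFamilyHom, vecMulVec_mulVec, hj']

/-- Evaluate the functional `α ⊗ x + β ⊗ y` on each matrix of a family. -/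
def bilinFamilyHom [Fintype m] (α β : m → K) (x y : n → K) : (ι → Matrix m n K) →+ (ι → K) where
  toFun A i := α ⬝ᵥ A i *ᵥ x + β ⬝ᵥ A i *ᵥ y
  map_zero' := by ext; simp
  map_add' A B := by
    ext
    simp only [Pi.add_apply, add_mulVec, dotProduct_add]
    ring

lemma bilinFamilyHom_surjective [Fintype m] [DecidableEq m] [DecidableEq n] {α β : m → K} {x y : n → K}
    (h : ∃ r c, α r * x c + β r * y c ≠ 0) :
    Function.Surjective (bilinFamilyHom (ι := ι) α β x y) := by
  obtain ⟨r, c, h⟩ := h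
  intro t
  refine ⟨fun i => Matrix.single r c (t i / (α r * x c + β r * y c)), ?_⟩
  funext i
  have key : ∀ z : n → K, ∀ a : K, Matrix.single r c a *ᵥ z = Pi.single r (a * z c) := by
    intro z a
    exact Matrix.single_mulVec ..
  simp only [bilinFamilyHom, AddMonoidHom.coe_mk, ZeroHom.coe_mk, key, dotProduct_single]
  field_simp

end

lemma card_biUnion_triples_le {ι X : Type*} [Fintype ι] [DecidableEq X] (V : ι → Finset X) :
    (Finset.univ.biUnion fun g => V g ×ˢ V g ×ˢ V g).card ≤ (∑ g, (V g).card) ^ 3 := by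
  calc _ ≤ ∑ g, (V g ×ˢ V g ×ˢ V g).card := Finset.card_biUnion_le
    _ ≤ ∑ g, (V g).card * (∑ g, (V g).card) ^ 2 := by
        refine Finset.sum_le_sum fun g _ => ?_
        have : (V g).card ≤ ∑ g, (V g).card :=
          Finset.single_le_sum (f := fun g => (V g).card) (fun _ _ => Nat.zero_le _)
            (Finset.mem_univ g)
        rw [Finset.card_product, Finset.card_product, sq]
        gcongr
    _ = _ := by rw [← Finset.sum_mul]; ring

theorem stmt_10 (k d ℓ n : ℕ) (hk : 1 ≤ k)
    (V : Fin k → Finset (Fin d → ZMod 5))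
    (hn : n = ∑ g : Fin k, (V g).card)
    (ha : ∀ g : Fin k, ∀ u ∈ V g, ∀ v ∈ V g, u ≠ v →
      ∀ a : ZMod 5, a ≠ 0 → u ≠ a • v)
    (hb : ∀ g : Fin k, ∀ u ∈ V g, ∀ v ∈ V g, ∀ w ∈ V g,
      u ≠ v → u ≠ w → v ≠ w →
      ∀ a : ZMod 5, a ≠ 0 → u - w ≠ a • (w - v))
    (hc : 4 * 5 ^ d ≤ 5 ^ (k * ℓ))
    (hd5 : 4 * n ^ 3 * 5 ^ (2 * k) ≤ 5 ^ ℓ) :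
    ∃ A : Fin ℓ → Matrix (Fin k) (Fin d) (ZMod 5),
      (∀ v : Fin d → ZMod 5, v ≠ 0 → ∃ j : Fin ℓ, (A j).mulVec v ≠ 0) ∧
      (∀ g : Fin k, ∀ u ∈ V g, ∀ v ∈ V g, u ≠ v →
        ∀ α : Fin k → ZMod 5, α ≠ 0 →
          (fun j : Fin ℓ => α ⬝ᵥ (A j).mulVec u) ≠ (fun j : Fin ℓ => α ⬝ᵥ (A j).mulVec v)) ∧
      (∀ g : Fin k, ∀ u ∈ V g, ∀ v ∈ V g, ∀ w ∈ V g,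
        u ≠ v → u ≠ w → v ≠ w →
        ∀ α α' : Fin k → ZMod 5, ¬(α = 0 ∧ α' = 0) →
          (fun j : Fin ℓ => α ⬝ᵥ (A j).mulVec u) + (fun j : Fin ℓ => α' ⬝ᵥ (A j).mulVec v) ≠
            (fun j : Fin ℓ => (α + α') ⬝ᵥ (A j).mulVec w)) := by
  classical
  have : Fact (Nat.Prime 5) := ⟨by norm_num⟩
  let s₁ : Finset (Fin d → ZMod 5) := Finset.univ.filter (· ≠ 0)
  let T₁ := fun v : Fin d → ZMod 5 => mulVecFamilyHom (m := Fin k) (ι := Fin ℓ) v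
  let s₂ := (((Finset.univ.biUnion fun g => V g ×ˢ V g ×ˢ V g) ×ˢ
    (Finset.univ : Finset ((Fin k → ZMod 5) × (Fin k → ZMod 5))))).filter fun p =>
      ∃ r c, p.2.1 r * (p.1.1 - p.1.2.2) c + p.2.2 r * (p.1.2.1 - p.1.2.2) c ≠ 0
  let T₂ := fun p : ((Fin d → ZMod 5) × (Fin d → ZMod 5) × (Fin d → ZMod 5)) ×
      ((Fin k → ZMod 5) × (Fin k → ZMod 5)) =>
    bilinFamilyHom (ι := Fin ℓ) p.2.1 p.2.2 (p.1.1 - p.1.2.2) (p.1.2.1 - p.1.2.2)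
  have b₁ := card_exists_map_eq_zero_mul_card_le s₁ T₁
    fun v hv => mulVecFamilyHom_surjective (Finset.mem_filter.mp hv).2
  have b₂ := card_exists_map_eq_zero_mul_card_le s₂ T₂
    fun p hp => bilinFamilyHom_surjective (Finset.mem_filter.mp hp).2
  have c₁ : s₁.card ≤ 5 ^ d := (Finset.card_le_univ _).trans (by simp [ZMod.card])
  have c₂ : s₂.card ≤ n ^ 3 * 5 ^ (2 * k) := by
    refine (Finset.card_filter_le _ _).trans ?_
    rw [Finset.card_product]
    refine Nat.mul_le_mul (hn ▸ card_biUnion_triples_le V) (le_of_eq ?_)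
    simp [ZMod.card, two_mul, pow_add]
  have f₁ : Fintype.card (Fin ℓ → Fin k → ZMod 5) = 5 ^ (k * ℓ) := by
    simp [ZMod.card, pow_mul]
  have f₂ : Fintype.card (Fin ℓ → ZMod 5) = 5 ^ ℓ := by simp [ZMod.card]
  rw [f₁] at b₁
  rw [f₂] at b₂
  set N := Fintype.card (Fin ℓ → Matrix (Fin k) (Fin d) (ZMod 5))
  have hN : 0 < N := Fintype.card_pos
  set B₁ := Finset.univ.filter fun A => ∃ v ∈ s₁, T₁ v A = 0
  set B₂ := Finset.univ.filter fun A => ∃ p ∈ s₂, T₂ p A = 0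
  have quarter : ∀ {b s q : ℕ}, 4 * s ≤ q → 0 < q → b * q ≤ s * N → 4 * b ≤ N := by
    intro b s q hs hq hb
    refine Nat.le_of_mul_le_mul_right ?_ hq
    nlinarith [Nat.mul_le_mul_right N hs]
  have q₁ : 4 * B₁.card ≤ N := quarter (by omega) (by positivity) b₁
  have q₂ : 4 * B₂.card ≤ N := quarter (by linarith) (by positivity) b₂
  obtain ⟨A, hA⟩ : ∃ A, A ∉ B₁ ∪ B₂ := by
    by_contra! h
    have := Finset.card_union_le B₁ B₂
    rw [Finset.eq_univ_iff_forall.mpr h, Finset.card_univ] at this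
    change N ≤ _ at this
    omega
  have good₁ : ∀ v ∈ s₁, T₁ v A ≠ 0 := fun v hv h0 =>
    hA (Finset.mem_union_left _ (Finset.mem_filter.mpr ⟨Finset.mem_univ _, v, hv, h0⟩))
  have good₂ : ∀ g, ∀ u ∈ V g, ∀ v ∈ V g, ∀ w ∈ V g, ∀ α β : Fin k → ZMod 5,
      (∃ r c, α r * (u - w) c + β r * (v - w) c ≠ 0) →
      ∃ j, α ⬝ᵥ A j *ᵥ (u - w) + β ⬝ᵥ A j *ᵥ (v - w) ≠ 0 := by
    intro g u hu v hv w hw α β h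
    by_contra! h0
    refine hA (Finset.mem_union_right _ (Finset.mem_filter.mpr
      ⟨Finset.mem_univ _, ((u, v, w), (α, β)), Finset.mem_filter.mpr ⟨?_, h⟩, funext h0⟩))
    simp only [Finset.mem_product, Finset.mem_biUnion, Finset.mem_univ, true_and, and_true]
    exact ⟨g, hu, hv, hw⟩
  refine ⟨A, fun v hv => ?_, fun g u hu v hv huv α hα e => ?_,
    fun g u hu v hv w hw huv huw hvw α β hαβ e => ?_⟩
  · exact Function.ne_iff.mp (good₁ v (by simpa [s₁] using hv))
  · obtain ⟨r, hr⟩ := Function.ne_iff.mp hα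
    obtain ⟨c, hc⟩ := Function.ne_iff.mp (sub_ne_zero.mpr huv)
    obtain ⟨j, hj⟩ := good₂ g u hu v hv v hv α 0 ⟨r, c, by simpa using mul_ne_zero hr hc⟩
    have ej := congrFun e j
    apply hj
    simp only [mulVec_sub, dotProduct_sub, zero_dotProduct]
    linear_combination ej
  · obtain ⟨j, hj⟩ := good₂ g u hu v hv w hw α β
      (exists_tensor_add_ne_zero (sub_ne_zero.mpr huw) (sub_ne_zero.mpr hvw)
        (fun a ha0 h => hb g u hu v hv w hw huv huw hvw (-a) (neg_ne_zero.mpr ha0) (by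
          rw [h, neg_smul, ← smul_neg, neg_sub])) hαβ)
    have ej := congrFun e j
    apply hj
    simp only [Pi.add_apply, add_dotProduct] at ej
    simp only [mulVec_sub, dotProduct_sub]
    linear_combination ej
end

section
/- Let k, ℓ be natural numbers. Let A, B, C : Fin k → Fin k → (Fin ℓ → ZMod 5), D, E : Fin k → (Fin ℓ → ZMod 5), and F₀ ∈ (Fin ℓ → ZMod 5), and define P : (Fin k → ZMod 5) → (Fin k → ZMod 5) → (Fin ℓ → ZMod 5) by P(α, β) = Σ_{i,j} (α_i·α_j) • A(i,j) + Σ_{i,j} (β_i·β_j) • B(i,j) + Σ_{i,j} (α_i·β_j) • C(i,j) + Σ_i α_i • D(i) + Σ_i β_i • E(i) + F₀. Suppose that the number of triples (α, α', β) ∈ ((Fin k → ZMod 5))³ with P(α + α', β) = P(α, β) + P(α', β) is greater than (2/5)·5^{3k}, and the number of triples (α, β, β') with P(α, β + β') = P(α, β) + P(α, β') is greater than (2/5)·5^{3k}. Then for all α, β, P(α, β) = Σ_{i,j} (α_i·β_j) • C(i,j). -/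
open Finset in
/-- The Schwartz–Zippel lemma over a finite field: a polynomial with more zeros than its
total degree permits is zero. -/
lemma MvPolynomial.eq_zero_of_totalDegree_lt_card_zeros {σ K : Type*} [Fintype σ] [Field K]
    [Fintype K] [DecidableEq K] [DecidableEq σ] (p : MvPolynomial σ K) {d : ℕ}
    (hd : p.totalDegree ≤ d)
    (hcard : (d / Fintype.card K : ℝ) * Fintype.card K ^ Fintype.card σ <
      (#{v : σ → K | eval v p = 0} : ℝ)) : p = 0 := by
  by_contra hp
  let e := Fintype.equivFin σ
  have hp' : rename e p ≠ 0 := (map_ne_zero_iff _ (rename_injective e e.injective)).2 hp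
  have hsz := schwartz_zippel_totalDegree hp' univ
  have hzeros : #{v : σ → K | eval v p = 0} =
      #{f ∈ Fintype.piFinset fun _ : Fin (Fintype.card σ) ↦ (univ : Finset K) |
        eval f (rename e p) = 0} := by
    refine card_equiv (Equiv.arrowCongr e (Equiv.refl K)) fun v ↦ ?_
    simp [eval_rename, Function.comp_assoc, Equiv.arrowCongr]
  have hq : (0 : ℝ) < Fintype.card K := by exact_mod_cast Fintype.card_pos
  rw [← hzeros, card_univ, ← NNRat.cast_le (K := ℝ)] at hsz
  push_cast at hsz
  rw [div_le_iff₀ (by positivity)] at hsz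
  refine (hcard.trans_le hsz).not_ge ?_
  have : ((rename e p).totalDegree : ℝ) ≤ d :=
    mod_cast (totalDegree_rename_le e p).trans hd
  gcongr

section QuadraticMap

variable {R S ι : Type*} [CommSemiring R] [CommSemiring S] [Algebra R S] [Fintype ι]

/-- The general inhomogeneous quadratic expression in two tuples of elements of an algebra. -/
def quadraticExpr (a b c : ι → ι → R) (d e : ι → R) (f : R) (x y : ι → S) : S :=
  (∑ i, ∑ j, a i j • (x i * x j)) + (∑ i, ∑ j, b i j • (y i * y j))
    + (∑ i, ∑ j, c i j • (x i * y j)) + (∑ i, d i • x i) + (∑ i, e i • y i) + algebraMap R S f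

open MvPolynomial in
lemma eval_quadraticExpr {σ : Type*} (a b c : ι → ι → R) (d e : ι → R) (f : R)
    (x y : ι → MvPolynomial σ R) (v : σ → R) :
    eval v (quadraticExpr a b c d e f x y) =
      quadraticExpr a b c d e f (fun i ↦ eval v (x i)) (fun i ↦ eval v (y i)) := by
  simp [quadraticExpr, smul_eval, algebraMap_eq]

open MvPolynomial in
lemma totalDegree_quadraticExpr_le {σ : Type*} (a b c : ι → ι → R) (d e : ι → R) (f : R)
    {x y : ι → MvPolynomial σ R} (hx : ∀ i, (x i).totalDegree ≤ 1)
    (hy : ∀ i, (y i).totalDegree ≤ 1) :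
    (quadraticExpr a b c d e f x y).totalDegree ≤ 2 := by
  have hadd {p q : MvPolynomial σ R} (hp : p.totalDegree ≤ 2) (hq : q.totalDegree ≤ 2) :
      (p + q).totalDegree ≤ 2 := (totalDegree_add p q).trans (max_le hp hq)
  have hbilin (m : ι → ι → R) {u w : ι → MvPolynomial σ R} (hu : ∀ i, (u i).totalDegree ≤ 1)
      (hw : ∀ i, (w i).totalDegree ≤ 1) : (∑ i, ∑ j, m i j • (u i * w j)).totalDegree ≤ 2 :=
    totalDegree_finsetSum_le fun i _ ↦ totalDegree_finsetSum_le fun j _ ↦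
      (totalDegree_smul_le _ _).trans <| (totalDegree_mul _ _).trans (add_le_add (hu i) (hw j))
  have hlin (m : ι → R) {u : ι → MvPolynomial σ R} (hu : ∀ i, (u i).totalDegree ≤ 1) :
      (∑ i, m i • u i).totalDegree ≤ 2 :=
    totalDegree_finsetSum_le fun i _ ↦
      (totalDegree_smul_le _ _).trans ((hu i).trans one_le_two)
  refine hadd (hadd (hadd (hadd (hadd ?_ ?_) ?_) ?_) ?_) ?_
  · exact hbilin a hx hx
  · exact hbilin b hy hy
  · exact hbilin c hx hy
  · exact hlin d hx
  · exact hlin e hy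
  · simp [algebraMap_eq]

end QuadraticMap

open Finset MvPolynomial in
/-- A quadratic polynomial in three vector variables over a finite field that vanishes on more than
a `2 / |K|` fraction of all triples vanishes everywhere. -/
lemma forall_eval_eq_zero_of_card_triples {K ι : Type*} [Field K] [Fintype K] [DecidableEq K]
    [Fintype ι] [DecidableEq ι] (p : MvPolynomial (ι ⊕ ι ⊕ ι) K) (hp : p.totalDegree ≤ 2)
    (T : Finset ((ι → K) × (ι → K) × (ι → K)))
    (hcard : (2 / Fintype.card K : ℝ) * Fintype.card K ^ (3 * Fintype.card ι) < #T)
    (hT : ∀ t ∈ T, eval (Sum.elim t.1 (Sum.elim t.2.1 t.2.2)) p = 0)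
    (u v w : ι → K) : eval (Sum.elim u (Sum.elim v w)) p = 0 := by
  have hle : #T ≤ #{g : ι ⊕ ι ⊕ ι → K | eval g p = 0} := by
    refine card_le_card_of_injOn (fun t ↦ Sum.elim t.1 (Sum.elim t.2.1 t.2.2))
      (fun t ht ↦ by simpa using hT t ht) ?_
    rintro ⟨t₁, t₂, t₃⟩ - ⟨s₁, s₂, s₃⟩ - h
    simpa [Sum.elim_eq_iff] using h
  have hσ : Fintype.card (ι ⊕ ι ⊕ ι) = 3 * Fintype.card ι := by
    simp only [Fintype.card_sum]; ring
  have : p = 0 := p.eq_zero_of_totalDegree_lt_card_zeros hp <| by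
    rw [hσ]
    exact_mod_cast hcard.trans_le (Nat.cast_le.2 hle)
  simp [this]

theorem stmt_11 (k ℓ : ℕ)
    (A B C : Fin k → Fin k → (Fin ℓ → ZMod 5))
    (D E : Fin k → (Fin ℓ → ZMod 5)) (F₀ : Fin ℓ → ZMod 5)
    (P : (Fin k → ZMod 5) → (Fin k → ZMod 5) → (Fin ℓ → ZMod 5))
    (hP : ∀ α β : Fin k → ZMod 5,
      P α β = (∑ i : Fin k, ∑ j : Fin k, (α i * α j) • A i j)
        + (∑ i : Fin k, ∑ j : Fin k, (β i * β j) • B i j)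
        + (∑ i : Fin k, ∑ j : Fin k, (α i * β j) • C i j)
        + (∑ i : Fin k, α i • D i) + (∑ i : Fin k, β i • E i) + F₀)
    (h1 : (2 / 5 : ℝ) * 5 ^ (3 * k) <
      ((Finset.univ.filter fun t : (Fin k → ZMod 5) × (Fin k → ZMod 5) × (Fin k → ZMod 5) =>
        P (t.1 + t.2.1) t.2.2 = P t.1 t.2.2 + P t.2.1 t.2.2).card : ℝ))
    (h2 : (2 / 5 : ℝ) * 5 ^ (3 * k) <
      ((Finset.univ.filter fun t : (Fin k → ZMod 5) × (Fin k → ZMod 5) × (Fin k → ZMod 5) =>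
        P t.1 (t.2.1 + t.2.2) = P t.1 t.2.1 + P t.1 t.2.2).card : ℝ)) :
    ∀ α β : Fin k → ZMod 5, P α β = ∑ i : Fin k, ∑ j : Fin k, (α i * β j) • C i j := by
  have hPc (α β : Fin k → ZMod 5) (n : Fin ℓ) : P α β n =
      quadraticExpr (A · · n) (B · · n) (C · · n) (D · n) (E · n) (F₀ n) α β := by
    simp [hP, quadraticExpr, mul_comm]
  have : Fact (Nat.Prime 5) := ⟨by norm_num⟩
  have hcard {N : ℕ} (h : (2 / 5 : ℝ) * 5 ^ (3 * k) < N) :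
      (2 / Fintype.card (ZMod 5) : ℝ) * Fintype.card (ZMod 5) ^ (3 * Fintype.card (Fin k)) < N := by
    simpa [ZMod.card] using h
  have hX (i : Fin k ⊕ Fin k ⊕ Fin k) :
      (MvPolynomial.X i : MvPolynomial _ (ZMod 5)).totalDegree ≤ 1 :=
    (MvPolynomial.totalDegree_X i).le
  have hXX (i j : Fin k ⊕ Fin k ⊕ Fin k) :
      (MvPolynomial.X i + MvPolynomial.X j : MvPolynomial _ (ZMod 5)).totalDegree ≤ 1 :=
    (MvPolynomial.totalDegree_add _ _).trans (max_le (hX i) (hX j))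
  have hsub {p q r : MvPolynomial (Fin k ⊕ Fin k ⊕ Fin k) (ZMod 5)} (hp : p.totalDegree ≤ 2)
      (hq : q.totalDegree ≤ 2) (hr : r.totalDegree ≤ 2) : (p - (q + r)).totalDegree ≤ 2 :=
    (MvPolynomial.totalDegree_sub _ _).trans <|
      max_le hp ((MvPolynomial.totalDegree_add _ _).trans (max_le hq hr))
  let x (i : Fin k) : MvPolynomial (Fin k ⊕ Fin k ⊕ Fin k) (ZMod 5) := .X (.inl i)
  let y (i : Fin k) : MvPolynomial (Fin k ⊕ Fin k ⊕ Fin k) (ZMod 5) := .X (.inr (.inl i))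
  let z (i : Fin k) : MvPolynomial (Fin k ⊕ Fin k ⊕ Fin k) (ZMod 5) := .X (.inr (.inr i))
  let Q (n : Fin ℓ) := quadraticExpr (S := MvPolynomial (Fin k ⊕ Fin k ⊕ Fin k) (ZMod 5))
    (A · · n) (B · · n) (C · · n) (D · n) (E · n) (F₀ n)
  have hleft (α α' β : Fin k → ZMod 5) : P (α + α') β = P α β + P α' β := by
    ext n
    have heval (u v w : Fin k → ZMod 5) :
        MvPolynomial.eval (Sum.elim u (Sum.elim v w))
          (Q n (fun i ↦ x i + y i) z - (Q n x z + Q n y z)) =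
        P (u + v) w n - (P u w n + P v w n) := by
      simp only [Q, x, y, z, map_sub, map_add, eval_quadraticExpr, hPc, MvPolynomial.eval_X,
        Sum.elim_inl, Sum.elim_inr]
      rfl
    have h := forall_eval_eq_zero_of_card_triples (Q n (fun i ↦ x i + y i) z - (Q n x z + Q n y z))
      (hsub (totalDegree_quadraticExpr_le _ _ _ _ _ _ (fun _ ↦ hXX _ _) fun _ ↦ hX _)
        (totalDegree_quadraticExpr_le _ _ _ _ _ _ (fun _ ↦ hX _) fun _ ↦ hX _)
        (totalDegree_quadraticExpr_le _ _ _ _ _ _ (fun _ ↦ hX _) fun _ ↦ hX _))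
      _ (hcard h1) (fun t ht ↦ by
        rw [heval, (Finset.mem_filter.1 ht).2, Pi.add_apply, sub_self]) α α' β
    rwa [heval, sub_eq_zero] at h
  have hright (α β β' : Fin k → ZMod 5) : P α (β + β') = P α β + P α β' := by
    ext n
    have heval (u v w : Fin k → ZMod 5) :
        MvPolynomial.eval (Sum.elim u (Sum.elim v w))
          (Q n x (fun i ↦ y i + z i) - (Q n x y + Q n x z)) =
        P u (v + w) n - (P u v n + P u w n) := by
      simp only [Q, x, y, z, map_sub, map_add, eval_quadraticExpr, hPc, MvPolynomial.eval_X,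
        Sum.elim_inl, Sum.elim_inr]
      rfl
    have h := forall_eval_eq_zero_of_card_triples (Q n x (fun i ↦ y i + z i) - (Q n x y + Q n x z))
      (hsub (totalDegree_quadraticExpr_le _ _ _ _ _ _ (fun _ ↦ hX _) fun _ ↦ hXX _ _)
        (totalDegree_quadraticExpr_le _ _ _ _ _ _ (fun _ ↦ hX _) fun _ ↦ hX _)
        (totalDegree_quadraticExpr_le _ _ _ _ _ _ (fun _ ↦ hX _) fun _ ↦ hX _))
      _ (hcard h2) (fun t ht ↦ by
        rw [heval, (Finset.mem_filter.1 ht).2, Pi.add_apply, sub_self]) α β β'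
    rwa [heval, sub_eq_zero] at h
  intro α β
  have hzero_left (β : Fin k → ZMod 5) : P 0 β = 0 := by simpa using hleft 0 0 β
  have hzero_right : P α 0 = 0 := by simpa using hright α 0 0
  have hF : F₀ = 0 := by simpa [hP] using hzero_left 0
  have hβ := hzero_left β
  simp only [hP, hF, Pi.zero_apply, zero_mul, mul_zero, zero_smul, Finset.sum_const_zero, zero_add,
    add_zero] at hβ hzero_right ⊢
  linear_combination hβ + hzero_right
end

section
/- Let V be a finite vertex type, G a simple graph on V, and k, d, t ≥ 1 natural numbers, with a coloring c : V → Fin k such that adjacent vertices of G receive distinct colors. Let H be a simple graph on Fin k in which every vertex has degree d, and let 0 ≤ λ ≤ 1 be a real number such that for every x : Fin k → ℝ with Σ_i x(i) = 0 one has Σ_i ((1/d)·Σ_{j : H.Adj i j} x(j))² ≤ λ²·Σ_i x(i)². Define the product graph G' as follows: its vertices are the tuples w : Fin t → V satisfying H.Adj (c (w i)) (c (w (i+1))) for every i with i+1 < t; two such tuples w, w' are adjacent in G' if and only if (i) c ∘ w ≠ c ∘ w' and (ii) any two distinct vertices lying in range(w) ∪ range(w') are adjacent in G. Then: (Completeness)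 if G contains a clique of size k, then G' contains a clique of size k·d^{t−1}; (Soundness) if ε ∈ (0,1) is a real number such that every clique of G has at most ε·k vertices, then every clique of G' with at least two vertices has at most k·d^{t−1}·((1−λ)·√ε + λ)^{t−1} vertices. -/
namespace SimpleGraph

variable {α : Type*} [Fintype α]

theorem IsRegularOfDegree.sum_sum_neighborFinset {H : SimpleGraph α} [DecidableRel H.Adj] {d : ℕ}
    (hreg : H.IsRegularOfDegree d) (x : α → ℝ) :
    ∑ i, ∑ j ∈ H.neighborFinset i, x j = d * ∑ i, x i := by
  rw [Finset.sum_comm' (t' := Finset.univ) (s' := fun j ↦ H.neighborFinset j)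
    (by simp [H.adj_comm]), Finset.mul_sum]
  simp [hreg.degree_eq]

/-- In an expander, averaging over neighbors contracts functions with small support. -/
theorem IsRegularOfDegree.sum_sq_average_le {H : SimpleGraph α} [DecidableRel H.Adj] {d : ℕ}
    (hreg : H.IsRegularOfDegree d) (hd : 1 ≤ d) (T : Finset α) {lam : ℝ}
    (hlam0 : 0 ≤ lam) (hlam1 : lam ≤ 1)
    (hexp : ∀ x : α → ℝ, (∑ i, x i) = 0 →
      ∑ i, ((1 / (d : ℝ)) * ∑ j ∈ H.neighborFinset i, x j) ^ 2 ≤ lam ^ 2 * ∑ i, (x i) ^ 2)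
    {ε : ℝ} (hε0 : 0 ≤ ε) (hε1 : ε ≤ 1) (hT : (T.card : ℝ) ≤ ε * Fintype.card α)
    (f : α → ℝ) (hf : ∀ i ∉ T, f i = 0) :
    ∑ i, ((1 / (d : ℝ)) * ∑ j ∈ H.neighborFinset i, f j) ^ 2 ≤
      ((1 - lam) * √ε + lam) ^ 2 * ∑ i, (f i) ^ 2 := by
  have hd0 : (d : ℝ) ≠ 0 := by positivity
  rcases isEmpty_or_nonempty α with h | h
  · simp
  have hN : (0 : ℝ) < Fintype.card α := by exact_mod_cast Fintype.card_pos
  set N : ℝ := (Fintype.card α : ℝ)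
  set m : ℝ := (∑ i, f i) / N with hm
  have hsum : ∑ i, f i = N * m := by rw [hm]; field_simp
  set g : α → ℝ := fun i ↦ f i - m
  have hg0 : ∑ i, g i = 0 := by
    simp only [g, Finset.sum_sub_distrib, hsum]
    simp [N]
  set a : α → ℝ := fun i ↦ (1 / (d : ℝ)) * ∑ j ∈ H.neighborFinset i, g j
  have hA : ∀ i, (1 / (d : ℝ)) * ∑ j ∈ H.neighborFinset i, f j = m + a i := by
    intro i
    simp only [a, g, Finset.sum_sub_distrib, Finset.sum_const, card_neighborFinset_eq_degree,
      hreg.degree_eq, nsmul_eq_mul]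
    field_simp
    ring
  have ha0 : ∑ i, a i = 0 := by
    simp only [a]
    rw [← Finset.mul_sum, hreg.sum_sum_neighborFinset, hg0]
    simp
  have ha : ∑ i, (a i) ^ 2 ≤ lam ^ 2 * ∑ i, (g i) ^ 2 := hexp g hg0
  have hg : ∑ i, (g i) ^ 2 = ∑ i, (f i) ^ 2 - N * m ^ 2 := by
    have : ∀ i, (g i) ^ 2 = (f i) ^ 2 - 2 * m * f i + m ^ 2 := fun i ↦ by simp only [g]; ring
    simp only [this, Finset.sum_add_distrib, Finset.sum_sub_distrib, ← Finset.mul_sum, hsum]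
    simp only [Finset.sum_const, Finset.card_univ, nsmul_eq_mul]
    ring
  have hAf : ∑ i, (m + a i) ^ 2 = N * m ^ 2 + ∑ i, (a i) ^ 2 := by
    simp only [add_sq, Finset.sum_add_distrib, ← Finset.mul_sum, ha0]
    simp [N]
  have hF : 0 ≤ ∑ i, (f i) ^ 2 := Finset.sum_nonneg fun i _ ↦ sq_nonneg _
  have hfm : N * m ^ 2 ≤ ε * ∑ i, (f i) ^ 2 := by
    have h1 : ∑ i ∈ T, f i = ∑ i, f i :=
      Finset.sum_subset (Finset.subset_univ T) fun i _ hi ↦ hf i hi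
    have h2 : ∑ i ∈ T, (f i) ^ 2 = ∑ i, (f i) ^ 2 :=
      Finset.sum_subset (Finset.subset_univ T) fun i _ hi ↦ by simp [hf i hi]
    have h3 := sq_sum_le_card_mul_sum_sq (s := T) (f := f)
    rw [h1, h2, hsum] at h3
    have h4 : N * (N * m ^ 2) ≤ N * (ε * ∑ i, (f i) ^ 2) :=
      calc N * (N * m ^ 2) = (N * m) ^ 2 := by ring
        _ ≤ _ := h3
        _ ≤ (ε * N) * ∑ i, (f i) ^ 2 := by gcongr
        _ = _ := by ring
    exact le_of_mul_le_mul_left h4 hN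
  have hs0 := Real.sqrt_nonneg ε
  have hs1 : √ε ≤ 1 := Real.sqrt_le_one.2 hε1
  have hs : ε = √ε ^ 2 := (Real.sq_sqrt hε0).symm
  have hcoef : ε * (1 - lam ^ 2) + lam ^ 2 ≤ ((1 - lam) * √ε + lam) ^ 2 := by
    have : 0 ≤ (1 - lam) * (2 * lam) * (√ε * (1 - √ε)) := by
      have := sub_nonneg.2 hlam1
      have := sub_nonneg.2 hs1
      positivity
    nlinarith
  have hlam : 0 ≤ 1 - lam ^ 2 := by nlinarith
  simp only [hA, hAf]
  rw [hg] at ha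
  calc N * m ^ 2 + ∑ i, (a i) ^ 2
      ≤ N * m ^ 2 * (1 - lam ^ 2) + lam ^ 2 * ∑ i, (f i) ^ 2 := by linarith
    _ ≤ ε * (∑ i, (f i) ^ 2) * (1 - lam ^ 2) + lam ^ 2 * ∑ i, (f i) ^ 2 := by gcongr
    _ = (ε * (1 - lam ^ 2) + lam ^ 2) * ∑ i, (f i) ^ 2 := by ring
    _ ≤ _ := by gcongr

variable [DecidableEq α]

/-- The walks with `n` steps in `H`, as tuples of `n + 1` vertices, that stay in `T`. -/
def walkTuples (H : SimpleGraph α) [DecidableRel H.Adj] (T : Finset α) (n : ℕ) :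
    Finset (Fin (n + 1) → α) :=
  {v | (∀ m, v m ∈ T) ∧ ∀ m : Fin n, H.Adj (v m.castSucc) (v m.succ)}

/-- The walks with `n` steps in `H` that start at `i` and stay in `T`. -/
def walkTuplesFrom (H : SimpleGraph α) [DecidableRel H.Adj] (T : Finset α) (n : ℕ) (i : α) :
    Finset (Fin (n + 1) → α) :=
  {v ∈ H.walkTuples T n | v 0 = i}

variable (H : SimpleGraph α) [DecidableRel H.Adj] (T : Finset α)

theorem mem_walkTuples {n : ℕ} {v : Fin (n + 1) → α} :
    v ∈ H.walkTuples T n ↔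
      (∀ m, v m ∈ T) ∧ ∀ m : Fin n, H.Adj (v m.castSucc) (v m.succ) := by
  simp [walkTuples]

theorem mem_walkTuplesFrom {n : ℕ} {i : α} {v : Fin (n + 1) → α} :
    v ∈ H.walkTuplesFrom T n i ↔ v ∈ H.walkTuples T n ∧ v 0 = i := by
  simp [walkTuplesFrom]

theorem card_walkTuples_eq_sum (n : ℕ) :
    (H.walkTuples T n).card = ∑ i, (H.walkTuplesFrom T n i).card :=
  Finset.card_eq_sum_card_fiberwise (by simp)

theorem walkTuplesFrom_of_notMem {i : α} (hi : i ∉ T) (n : ℕ) :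
    H.walkTuplesFrom T n i = ∅ := by
  refine Finset.eq_empty_of_forall_notMem fun v hv ↦ hi ?_
  rw [mem_walkTuplesFrom, mem_walkTuples] at hv
  exact hv.2 ▸ hv.1.1 0

theorem card_walkTuplesFrom_zero {i : α} (hi : i ∈ T) :
    (H.walkTuplesFrom T 0 i).card = 1 := by
  refine Finset.card_eq_one.2 ⟨fun _ ↦ i, ?_⟩
  ext v
  simp only [mem_walkTuplesFrom, mem_walkTuples, Finset.mem_singleton]
  constructor
  · rintro ⟨-, h⟩
    funext m
    rwa [Fin.fin_one_eq_zero m]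
  · rintro rfl
    exact ⟨⟨fun _ ↦ hi, fun m ↦ m.elim0⟩, rfl⟩

theorem walkTuplesFrom_succ {i : α} (hi : i ∈ T) (n : ℕ) :
    H.walkTuplesFrom T (n + 1) i = (H.neighborFinset i).biUnion fun j ↦
      (H.walkTuplesFrom T n j).image (Fin.cons (α := fun _ ↦ α) i) := by
  ext v
  simp only [mem_walkTuplesFrom, mem_walkTuples, Finset.mem_biUnion, Finset.mem_image,
    mem_neighborFinset]
  constructor
  · rintro ⟨⟨hT, hH⟩, rfl⟩
    exact ⟨v 1, hH 0, Fin.tail v, ⟨⟨fun m ↦ hT m.succ, fun m ↦ hH m.succ⟩, rfl⟩,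
      Fin.cons_self_tail v⟩
  · rintro ⟨j, hij, u, ⟨⟨hT, hH⟩, rfl⟩, rfl⟩
    refine ⟨⟨Fin.cases hi hT, Fin.cases hij hH⟩, rfl⟩

theorem card_walkTuplesFrom_succ {i : α} (hi : i ∈ T) (n : ℕ) :
    (H.walkTuplesFrom T (n + 1) i).card =
      ∑ j ∈ H.neighborFinset i, (H.walkTuplesFrom T n j).card := by
  rw [walkTuplesFrom_succ H T hi, Finset.card_biUnion]
  · exact Finset.sum_congr rfl fun j _ ↦
      Finset.card_image_of_injective _ (Fin.cons_right_injective _)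
  · intro j _ j' _ hjj'
    refine Finset.disjoint_left.2 fun v hv hv' ↦ hjj' ?_
    obtain ⟨u, hu, rfl⟩ := Finset.mem_image.1 hv
    obtain ⟨u', hu', h⟩ := Finset.mem_image.1 hv'
    obtain rfl := Fin.cons_right_injective _ h
    exact ((mem_walkTuplesFrom H T).1 hu).2.symm.trans ((mem_walkTuplesFrom H T).1 hu').2

theorem IsRegularOfDegree.card_walkTuples_univ {H : SimpleGraph α} [DecidableRel H.Adj] {d : ℕ}
    (hreg : H.IsRegularOfDegree d) (n : ℕ) :
    (H.walkTuples Finset.univ n).card = Fintype.card α * d ^ n := by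
  have key : ∀ i, (H.walkTuplesFrom Finset.univ n i).card = d ^ n := by
    induction n with
    | zero => exact fun i ↦ card_walkTuplesFrom_zero H _ (Finset.mem_univ i)
    | succ n ih =>
      intro i
      simp [card_walkTuplesFrom_succ, ih, hreg.degree_eq i, pow_succ']
  simp [card_walkTuples_eq_sum, key]

/-- Few walks in an expander stay inside a small set. -/
theorem IsRegularOfDegree.card_walkTuples_le {H : SimpleGraph α} [DecidableRel H.Adj] {d : ℕ}
    (hreg : H.IsRegularOfDegree d) (hd : 1 ≤ d) {lam : ℝ} (hlam0 : 0 ≤ lam) (hlam1 : lam ≤ 1)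
    (hexp : ∀ x : α → ℝ, (∑ i, x i) = 0 →
      ∑ i, ((1 / (d : ℝ)) * ∑ j ∈ H.neighborFinset i, x j) ^ 2 ≤ lam ^ 2 * ∑ i, (x i) ^ 2)
    {ε : ℝ} (hε0 : 0 ≤ ε) (hε1 : ε ≤ 1) (hT : (T.card : ℝ) ≤ ε * Fintype.card α) (n : ℕ) :
    ((H.walkTuples T n).card : ℝ) ≤ T.card * (d * ((1 - lam) * √ε + lam)) ^ n := by
  have hd0 : (d : ℝ) ≠ 0 := by positivity
  set μ : ℝ := (1 - lam) * √ε + lam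
  have hμ0 : 0 ≤ μ := by
    have := sub_nonneg.2 hlam1
    positivity
  have hzero : ∀ n, ∀ i ∉ T, ((H.walkTuplesFrom T n i).card : ℝ) = 0 := fun n i hi ↦ by
    simp [walkTuplesFrom_of_notMem H T hi]
  have hsq : ∀ n, ∑ i, ((H.walkTuplesFrom T n i).card : ℝ) ^ 2 ≤ T.card * ((d * μ) ^ n) ^ 2 := by
    intro n
    induction n with
    | zero =>
      rw [← Finset.sum_subset (Finset.subset_univ T) fun i _ hi ↦ by simp [hzero 0 i hi],
        Finset.sum_congr rfl fun i hi ↦ by rw [card_walkTuplesFrom_zero H T hi]]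
      simp
    | succ n ih =>
      calc ∑ i, ((H.walkTuplesFrom T (n + 1) i).card : ℝ) ^ 2
          ≤ ∑ i, (d : ℝ) ^ 2 * ((1 / (d : ℝ)) *
              ∑ j ∈ H.neighborFinset i, ((H.walkTuplesFrom T n j).card : ℝ)) ^ 2 := by
            refine Finset.sum_le_sum fun i _ ↦ ?_
            by_cases hi : i ∈ T
            · rw [card_walkTuplesFrom_succ H T hi, ← mul_pow, ← mul_assoc, mul_one_div_cancel hd0,
                one_mul, Nat.cast_sum]
            · rw [hzero _ i hi, zero_pow two_ne_zero]
              exact mul_nonneg (sq_nonneg _) (sq_nonneg _)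
        _ ≤ (d : ℝ) ^ 2 * (μ ^ 2 * ∑ i, ((H.walkTuplesFrom T n i).card : ℝ) ^ 2) := by
            rw [← Finset.mul_sum]
            gcongr
            exact hreg.sum_sq_average_le hd T hlam0 hlam1 hexp hε0 hε1 hT _ (hzero n)
        _ ≤ (d : ℝ) ^ 2 * (μ ^ 2 * (T.card * ((d * μ) ^ n) ^ 2)) := by gcongr
        _ = T.card * ((d * μ) ^ (n + 1)) ^ 2 := by ring
  refine le_of_sq_le_sq ?_ (by positivity)
  rw [card_walkTuples_eq_sum, Nat.cast_sum,
    ← Finset.sum_subset (Finset.subset_univ T) fun i _ hi ↦ hzero n i hi]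
  calc (∑ i ∈ T, ((H.walkTuplesFrom T n i).card : ℝ)) ^ 2
      ≤ T.card * ∑ i ∈ T, ((H.walkTuplesFrom T n i).card : ℝ) ^ 2 := sq_sum_le_card_mul_sum_sq
    _ ≤ T.card * ∑ i, ((H.walkTuplesFrom T n i).card : ℝ) ^ 2 := by
        gcongr
        exact Finset.subset_univ T
    _ ≤ T.card * (T.card * ((d * μ) ^ n) ^ 2) := by gcongr; exact hsq n
    _ = _ := by ring

end SimpleGraph

theorem stmt_12 {V : Type*} [Fintype V] (G : SimpleGraph V)
    (k d t : ℕ) (hk : 1 ≤ k) (hd : 1 ≤ d) (ht : 1 ≤ t)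
    (c : V → Fin k) (hc : ∀ u v : V, G.Adj u v → c u ≠ c v)
    (H : SimpleGraph (Fin k)) [DecidableRel H.Adj]
    (hreg : ∀ i : Fin k, H.degree i = d)
    (lam : ℝ) (hlam0 : 0 ≤ lam) (hlam1 : lam ≤ 1)
    (hexp : ∀ x : Fin k → ℝ, (∑ i, x i) = 0 →
      ∑ i, ((1 / (d : ℝ)) * ∑ j ∈ H.neighborFinset i, x j) ^ 2 ≤
        lam ^ 2 * ∑ i, (x i) ^ 2)
    (G' : SimpleGraph {w : Fin t → V //
      ∀ i : Fin t, ∀ hi : (i : ℕ) + 1 < t, H.Adj (c (w i)) (c (w ⟨(i : ℕ) + 1, hi⟩))})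
    (hG' : ∀ w w', G'.Adj w w' ↔
      (c ∘ w.1 ≠ c ∘ w'.1) ∧
      ∀ u v : V, u ∈ Set.range w.1 ∪ Set.range w'.1 →
        v ∈ Set.range w.1 ∪ Set.range w'.1 → u ≠ v → G.Adj u v) :
    ((∃ S : Finset V, G.IsNClique k S) →
      ∃ S', G'.IsNClique (k * d ^ (t - 1)) S') ∧
    (∀ ε : ℝ, 0 < ε → ε < 1 →
      (∀ S : Finset V, G.IsClique (S : Set V) → (S.card : ℝ) ≤ ε * k) →
      ∀ S' : Finset {w : Fin t → V //
          ∀ i : Fin t, ∀ hi : (i : ℕ) + 1 < t, H.Adj (c (w i)) (c (w ⟨(i : ℕ) + 1, hi⟩))},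
        G'.IsClique (S' : Set _) → 2 ≤ S'.card →
        (S'.card : ℝ) ≤ (k : ℝ) * (d : ℝ) ^ (t - 1) *
          ((1 - lam) * Real.sqrt ε + lam) ^ (t - 1)) := by
  classical
  obtain ⟨n, rfl⟩ : ∃ n, t = n + 1 := ⟨t - 1, by omega⟩
  have hreg' : H.IsRegularOfDegree d := hreg
  rw [Nat.add_sub_cancel]
  constructor
  · rintro ⟨S, hS⟩
    have hinj : Set.InjOn c S := fun u hu v hv huv ↦ by
      by_contra hne
      exact hc u v (hS.isClique hu hv hne) huv
    have himg : S.image c = Finset.univ := by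
      rw [← Finset.card_eq_iff_eq_univ, Finset.card_image_of_injOn hinj, hS.card_eq,
        Fintype.card_fin]
    have hsurj : ∀ i, ∃ v ∈ S, c v = i := fun i ↦
      Finset.mem_image.1 (himg ▸ Finset.mem_univ i)
    choose g hgS hcg using hsurj
    have hcomp : ∀ v : Fin (n + 1) → Fin k, c ∘ (g ∘ v) = v := fun v ↦ funext fun m ↦ hcg _
    let φ : H.walkTuples Finset.univ n ↪ {w : Fin (n + 1) → V //
        ∀ i : Fin (n + 1), ∀ hi : (i : ℕ) + 1 < n + 1,
          H.Adj (c (w i)) (c (w ⟨(i : ℕ) + 1, hi⟩))} :=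
      { toFun := fun v ↦ ⟨g ∘ v.1, fun i hi ↦ by
          simp only [Function.comp_apply, hcg]
          exact ((SimpleGraph.mem_walkTuples H _).1 v.2).2 ⟨i, by omega⟩⟩
        inj' := fun v v' h ↦ Subtype.ext <| by
          rw [← hcomp v.1, ← hcomp v'.1]
          exact congrArg (c ∘ ·) (congrArg Subtype.val h) }
    refine ⟨Finset.univ.map φ, ?_, ?_⟩
    · intro w hw w' hw' hne
      obtain ⟨v, -, rfl⟩ := Finset.mem_map.1 (Finset.mem_coe.1 hw)
      obtain ⟨v', -, rfl⟩ := Finset.mem_map.1 (Finset.mem_coe.1 hw')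
      refine (hG' _ _).2 ⟨fun h ↦ hne ?_, fun a b ha hb hab ↦ hS.isClique ?_ ?_ hab⟩
      · have h' : v.1 = v'.1 := by
          rw [← hcomp v.1, ← hcomp v'.1]
          exact h
        rw [Subtype.ext h']
      · rcases ha with ⟨m, rfl⟩ | ⟨m, rfl⟩ <;> exact hgS _
      · rcases hb with ⟨m, rfl⟩ | ⟨m, rfl⟩ <;> exact hgS _
    · rw [Finset.card_map, Finset.card_univ, Fintype.card_coe, hreg'.card_walkTuples_univ,
        Fintype.card_fin]
  · intro ε hε0 hε1 hG S' hS' hcard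
    let U : Finset V := {u | ∃ w ∈ S', u ∈ Set.range w.1}
    have hU : G.IsClique (U : Set V) := by
      intro a ha b hb hab
      obtain ⟨w, hw, ha⟩ := (Finset.mem_filter.1 (Finset.mem_coe.1 ha)).2
      obtain ⟨w', hw', hb⟩ := (Finset.mem_filter.1 (Finset.mem_coe.1 hb)).2
      by_cases hww' : w = w'
      · subst hww'
        obtain ⟨w'', hw'', hne⟩ := Finset.exists_mem_ne (show 1 < S'.card by omega) w
        exact ((hG' _ _).1 (hS' hw hw'' hne.symm)).2 a b (.inl ha) (.inl hb) hab
      · exact ((hG' _ _).1 (hS' hw hw' hww')).2 a b (.inl ha) (.inr hb) hab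
    have hT : ((U.image c).card : ℝ) ≤ ε * Fintype.card (Fin k) := by
      rw [Fintype.card_fin]
      exact (Nat.cast_le.2 Finset.card_image_le).trans (hG U hU)
    have hle : S'.card ≤ (H.walkTuples (U.image c) n).card := by
      refine Finset.card_le_card_of_injOn (fun w ↦ c ∘ w.1) (fun w hw ↦ ?_)
        fun w hw w' hw' h ↦ ?_
      · refine Finset.mem_coe.2 ((SimpleGraph.mem_walkTuples H _).2 ⟨fun m ↦ ?_, fun m ↦ ?_⟩)
        · exact Finset.mem_image_of_mem c
            (Finset.mem_filter.2 ⟨Finset.mem_univ _, w, hw, m, rfl⟩)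
        · exact w.2 m.castSucc (by simp)
      · by_contra hne
        exact ((hG' _ _).1 (hS' hw hw' hne)).1 h
    have hμ0 : 0 ≤ (1 - lam) * √ε + lam := by
      have := sub_nonneg.2 hlam1
      positivity
    have hTk : ((U.image c).card : ℝ) ≤ k := by
      exact_mod_cast (Finset.card_le_univ _).trans_eq (Fintype.card_fin k)
    calc (S'.card : ℝ) ≤ (H.walkTuples (U.image c) n).card := by exact_mod_cast hle
      _ ≤ (U.image c).card * (d * ((1 - lam) * √ε + lam)) ^ n :=
          hreg'.card_walkTuples_le _ hd hlam0 hlam1 hexp hε0.le hε1.le hT n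
      _ ≤ k * (d * ((1 - lam) * √ε + lam)) ^ n := by gcongr
      _ = _ := by rw [mul_pow, mul_assoc]
end

section
/- Let V be a finite vertex type, G a simple graph on V, k a natural number, and c : V → Fin k a coloring such that adjacent vertices of G receive distinct colors. Define a bipartite graph G' on V ⊕ V (left and right copies of V) in which there are no edges within a side, and a left vertex u is adjacent to a right vertex w if and only if u = w, or (c(u) ≠ c(w) and G.Adj u w). Then: (Completeness) if G contains a clique K of size k, then there exist S, T : Finset V with |S| = |T| = k, c injective on S and on T, and every element of S adjacent in G' (as a left vertex) to every element of T (as a right vertex). (Soundness) for any natural number s, if S, T : Finset V satisfy |S| = |T| = s, c is injective on S and on T, and every element of S is adjacent in G' (as a left vertex) to every element of T (as a right vertex), then G contains a clique of size at least 2s − k. -/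
theorem stmt_13 {V : Type*} [Fintype V] [DecidableEq V] (G : SimpleGraph V) (k : ℕ)
    (c : V → Fin k) (hc : ∀ u v : V, G.Adj u v → c u ≠ c v)
    (G' : SimpleGraph (V ⊕ V))
    (hG'1 : ∀ u w : V, G'.Adj (Sum.inl u) (Sum.inr w) ↔
      (u = w ∨ (c u ≠ c w ∧ G.Adj u w)))
    (hG'2 : ∀ u u' : V, ¬ G'.Adj (Sum.inl u) (Sum.inl u'))
    (hG'3 : ∀ w w' : V, ¬ G'.Adj (Sum.inr w) (Sum.inr w')) :
    ((∃ K : Finset V, G.IsNClique k K) →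
      ∃ S T : Finset V, S.card = k ∧ T.card = k ∧
        Set.InjOn c (S : Set V) ∧ Set.InjOn c (T : Set V) ∧
        ∀ u ∈ S, ∀ w ∈ T, G'.Adj (Sum.inl u) (Sum.inr w)) ∧
    (∀ s : ℕ, ∀ S T : Finset V, S.card = s → T.card = s →
      Set.InjOn c (S : Set V) → Set.InjOn c (T : Set V) →
      (∀ u ∈ S, ∀ w ∈ T, G'.Adj (Sum.inl u) (Sum.inr w)) →
      ∃ K : Finset V, G.IsClique (K : Set V) ∧ 2 * (s : ℤ) - (k : ℤ) ≤ (K.card : ℤ)) := by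
  refine ⟨?_, ?_⟩
  · rintro ⟨K, hK⟩
    have hinj : Set.InjOn c (K : Set V) := by
      intro u hu v hv huv
      by_contra hne
      exact hc u v (hK.isClique hu hv hne) huv
    refine ⟨K, K, hK.card_eq, hK.card_eq, hinj, hinj, fun u hu w hw => (hG'1 u w).2 ?_⟩
    by_cases h : u = w
    · exact Or.inl h
    · have hadj := hK.isClique hu hw h
      exact Or.inr ⟨hc u w hadj, hadj⟩
  · intro s S T hS hT hcS hcT hST
    refine ⟨S ∩ T, ?_, ?_⟩
    · intro u hu w hw hne
      have hu' := Finset.mem_inter.1 (Finset.mem_coe.1 hu)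
      have hw' := Finset.mem_inter.1 (Finset.mem_coe.1 hw)
      rcases (hG'1 u w).1 (hST u hu'.1 w hw'.2) with h | h
      · exact absurd h hne
      · exact h.2
    · have hsub : S.image c ∩ T.image c ⊆ (S ∩ T).image c := by
        intro a ha
        obtain ⟨haS, haT⟩ := Finset.mem_inter.1 ha
        obtain ⟨u, hu, rfl⟩ := Finset.mem_image.1 haS
        obtain ⟨w, hw, hwu⟩ := Finset.mem_image.1 haT
        rcases (hG'1 u w).1 (hST u hu w hw) with rfl | h
        · exact Finset.mem_image_of_mem c (Finset.mem_inter.2 ⟨hu, hw⟩)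
        · exact absurd hwu.symm h.1
      have hle := (Finset.card_le_card hsub).trans Finset.card_image_le
      have hsum := Finset.card_union_add_card_inter (S.image c) (T.image c)
      have huniv : (S.image c ∪ T.image c).card ≤ k := by
        simpa using Finset.card_le_univ (S.image c ∪ T.image c)
      rw [Finset.card_image_of_injOn hcS, Finset.card_image_of_injOn hcT, hS, hT] at hsum
      omega
end

section
/- Let U, W be finite types (left and right vertices of a bipartite graph) with group maps c_U : U → Fin k and c_W : W → Fin k, and let Eg : U → W → Prop be an edge relation. Let ℓ, r be natural numbers and ε ∈ (0,1) a real number, and let I : Fin k → Finset (Fin k) be a family with |I(i)| = ℓ for all i such that for every S : Finset (Fin k) with |S| = r, |⋃_{i ∈ S} I(i)| ≥ ε·k (i.e., I is a (k, k, ℓ, r, 1−ε)-disperser). Suppose there exist T_L, T_R : Finset (Fin k) with |T_L| = |T_R| = r and finite sets A_U : Finset U, A_W : Finset W such that: every color in ⋃_{s ∈ T_L} I(s) equals c_U(a) for some a ∈ A_U; every color in ⋃_{s ∈ T_R} I(s) equals c_W(b) for some b ∈ A_W; and Eg a b holds for every a ∈ A_U and b ∈ A_W. Then there exist S_U : Finset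 U and S_W : Finset W with c_U injective on S_U, c_W injective on S_W, |S_U| ≥ ε·k, |S_W| ≥ ε·k, and Eg a b for every a ∈ S_U and b ∈ S_W. -/
theorem stmt_14 {U W : Type*} [DecidableEq U] [DecidableEq W] (k : ℕ)
    (cU : U → Fin k) (cW : W → Fin k) (Eg : U → W → Prop)
    (ℓ r : ℕ) (ε : ℝ) (hε0 : 0 < ε) (hε1 : ε < 1)
    (I : Fin k → Finset (Fin k)) (hI : ∀ i : Fin k, (I i).card = ℓ)
    (hdisp : ∀ S : Finset (Fin k), S.card = r → ε * k ≤ ((S.biUnion I).card : ℝ))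
    (TL TR : Finset (Fin k)) (hTL : TL.card = r) (hTR : TR.card = r)
    (AU : Finset U) (AW : Finset W)
    (hAU : ∀ i ∈ TL.biUnion I, ∃ a ∈ AU, cU a = i)
    (hAW : ∀ i ∈ TR.biUnion I, ∃ b ∈ AW, cW b = i)
    (hE : ∀ a ∈ AU, ∀ b ∈ AW, Eg a b) :
    ∃ SU : Finset U, ∃ SW : Finset W,
      Set.InjOn cU (SU : Set U) ∧ Set.InjOn cW (SW : Set W) ∧
      ε * k ≤ (SU.card : ℝ) ∧ ε * k ≤ (SW.card : ℝ) ∧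
      ∀ a ∈ SU, ∀ b ∈ SW, Eg a b := by
  obtain ⟨SU, hSU, injU, imgU⟩ :=
    Finset.exists_subset_injOn_image_eq_of_surjOn (f := cU) (AU : Set U) (TL.biUnion I) hAU
  obtain ⟨SW, hSW, injW, imgW⟩ :=
    Finset.exists_subset_injOn_image_eq_of_surjOn (f := cW) (AW : Set W) (TR.biUnion I) hAW
  refine ⟨SU, SW, injU, injW, ?_, ?_, fun a ha b hb => hE a (hSU ha) b (hSW hb)⟩
  · rw [← Finset.card_image_of_injOn injU, imgU]
    exact hdisp TL hTL
  · rw [← Finset.card_image_of_injOn injW, imgW]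
    exact hdisp TR hTR
end

section
/- Let X be a finite type (of variables) and k ≥ 1 a natural number, and let app : X → Finset (Fin k) satisfy 2 ≤ |app(x)| ≤ 3 for all x. For partial assignments σ : Fin k → X → Bool, define for each i ∈ Fin k the vector vec(σ, i) : X × Fin 2 → ZMod 5 by: vec(σ, i)(x, 0) = (if i ∈ app(x) and σ i x = true then (if i = min(app x) then 1 else if i = min(app x \ {min(app x)}) then −1 else 0) else 0), and vec(σ, i)(x, 1) = (if i ∈ app(x) and σ i x = true and |app(x)| = 3 then (if i = min(app x) then 1 else if i = max(app x) then −1 else 0) else 0). Then Σ_{i ∈ Fin k} vec(σ, i) = 0 if and only if for every x ∈ X and all i, j ∈ app(x), σ i x = σ j x. -/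
/-- The vector encoding of the `i`-th partial assignment `σ i`, used in the
reduction from 3SAT to `k`-VectorSum. -/
def satVec {X : Type*} {k : ℕ} (app : X → Finset (Fin k))
    (σ : Fin k → X → Bool) (i : Fin k) : X × Fin 2 → ZMod 5 :=
  fun q =>
    if hne : (app q.1).Nonempty then
      if q.2 = 0 then
        -- first coordinate associated to the variable `q.1`
        if i ∈ app q.1 ∧ σ i q.1 = true then
          if i = (app q.1).min' hne then 1
          else if hne2 : ((app q.1).erase ((app q.1).min' hne)).Nonempty then
            if i = ((app q.1).erase ((app q.1).min' hne)).min' hne2 then -1 else 0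
          else 0
        else 0
      else
        -- second coordinate associated to the variable `q.1`
        if i ∈ app q.1 ∧ σ i q.1 = true ∧ (app q.1).card = 3 then
          if i = (app q.1).min' hne then 1
          else if i = (app q.1).max' hne then -1 else 0
        else 0
    else 0

/-- A signed indicator sum over two distinct indices is the difference of their truth values. -/
theorem sum_signed_indicator {ι : Type*} [Fintype ι] [DecidableEq ι] (s : ι → Bool) {p q : ι}
    (hpq : p ≠ q) {f : ι → ZMod 5}
    (hf : ∀ i, f i = if s i = true then (if i = p then 1 else if i = q then -1 else 0) else 0) :
    ∑ i, f i = (if s p = true then 1 else 0) - (if s q = true then 1 else 0) := by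
  have h : ∀ i, f i = (if i = p then (if s p = true then 1 else 0) else 0) -
      (if i = q then (if s q = true then 1 else 0) else 0) := by
    intro i
    rw [hf]
    by_cases hp : i = p
    · subst hp
      simp [hpq]
    · by_cases hq : i = q
      · subst hq
        by_cases hs : s i = true <;> simp [hp, hs]
      · simp [hp, hq]
  simp [h, Finset.sum_sub_distrib]

theorem indicator_sub_eq_zero_iff (u v : Bool) :
    (if u = true then (1 : ZMod 5) else 0) - (if v = true then 1 else 0) = 0 ↔ u = v := by
  revert u v
  decide

theorem satVec_sum_fst {X : Type*} {k : ℕ} (app : X → Finset (Fin k)) (σ : Fin k → X → Bool)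
    (x : X) (hne : (app x).Nonempty) (hne2 : ((app x).erase ((app x).min' hne)).Nonempty) :
    ∑ i, satVec app σ i (x, 0) = 0 ↔
      σ ((app x).min' hne) x = σ (((app x).erase ((app x).min' hne)).min' hne2) x := by
  have hb := Finset.min'_mem _ hne2
  rw [Finset.mem_erase] at hb
  have ha := Finset.min'_mem _ hne
  rw [sum_signed_indicator (fun i => σ i x) hb.1.symm, indicator_sub_eq_zero_iff]
  intro i
  simp only [satVec, hne, hne2, dite_true, if_true]
  by_cases hi : i ∈ app x
  · simp [hi]
  · have h1 : i ≠ (app x).min' hne := fun h => hi (h ▸ ha)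
    have h2 : i ≠ ((app x).erase ((app x).min' hne)).min' hne2 := fun h => hi (h ▸ hb.2)
    simp [hi, h1, h2]

theorem satVec_sum_snd {X : Type*} {k : ℕ} (app : X → Finset (Fin k)) (σ : Fin k → X → Bool)
    (x : X) (hne : (app x).Nonempty) (hcard : (app x).card = 3) :
    ∑ i, satVec app σ i (x, 1) = 0 ↔
      σ ((app x).min' hne) x = σ ((app x).max' hne) x := by
  have ha := Finset.min'_mem _ hne
  have hc := Finset.max'_mem _ hne
  have hac := (Finset.min'_lt_max'_of_card (app x) (by omega)).ne
  rw [sum_signed_indicator (fun i => σ i x) hac, indicator_sub_eq_zero_iff]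
  intro i
  simp only [satVec, hne, hcard, dite_true, one_ne_zero, if_false, and_true]
  by_cases hi : i ∈ app x
  · simp [hi]
  · have h1 : i ≠ (app x).min' hne := fun h => hi (h ▸ ha)
    have h2 : i ≠ (app x).max' hne := fun h => hi (h ▸ hc)
    simp [hi, h1, h2]

theorem satVec_sum_snd_of_card_ne {X : Type*} {k : ℕ} (app : X → Finset (Fin k))
    (σ : Fin k → X → Bool) (x : X) (hcard : (app x).card ≠ 3) :
    ∑ i, satVec app σ i (x, 1) = 0 := by
  simp [satVec, hcard]

/-- In a linear order, a set of two or three elements consists of its smallest element,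
its second smallest element and its largest element. -/
theorem eq_min_or_eq_second_or_eq_max {α : Type*} [LinearOrder α] {S : Finset α}
    (h3 : S.card ≤ 3) (hne : S.Nonempty) (hne2 : (S.erase (S.min' hne)).Nonempty)
    {i : α} (hi : i ∈ S) :
    i = S.min' hne ∨ i = (S.erase (S.min' hne)).min' hne2 ∨ S.card = 3 ∧ i = S.max' hne := by
  by_contra! hcon
  obtain ⟨h1, h2, hmax⟩ := hcon
  set a := S.min' hne
  set b := (S.erase a).min' hne2
  have hbm : b ∈ S.erase a := Finset.min'_mem _ hne2
  have hbi : b < i := lt_of_le_of_ne (Finset.min'_le _ _ (Finset.mem_erase.2 ⟨h1, hi⟩)) h2.symm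
  rw [Finset.mem_erase] at hbm
  have haS : a ∈ S := Finset.min'_mem _ hne
  have hsub : {a, b, i} ⊆ S := by
    simp [Finset.insert_subset_iff, haS, hbm.2, hi]
  have hc : ({a, b, i} : Finset α).card = 3 :=
    Finset.card_eq_three.2 ⟨a, b, i, hbm.1.symm, h1.symm, h2.symm, rfl⟩
  have hS : {a, b, i} = S := Finset.eq_of_subset_of_card_le hsub (by omega)
  have hab : a ≤ b := Finset.min'_le _ _ hbm.2
  refine hmax (hS ▸ hc) (le_antisymm (Finset.le_max' _ _ hi) (Finset.max'_le _ _ _ ?_))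
  intro y hy
  rw [← hS] at hy
  simp only [Finset.mem_insert, Finset.mem_singleton] at hy
  rcases hy with rfl | rfl | rfl
  · exact hab.trans hbi.le
  · exact hbi.le
  · exact le_rfl

theorem stmt_15 {X : Type*} [Fintype X] (k : ℕ) (hk : 1 ≤ k)
    (app : X → Finset (Fin k))
    (happ : ∀ x : X, 2 ≤ (app x).card ∧ (app x).card ≤ 3)
    (σ : Fin k → X → Bool) :
    (∑ i : Fin k, satVec app σ i) = 0 ↔
      ∀ x : X, ∀ i ∈ app x, ∀ j ∈ app x, σ i x = σ j x := by
  have hfun : (∑ i : Fin k, satVec app σ i) = 0 ↔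
      ∀ x, ∑ i, satVec app σ i (x, 0) = 0 ∧ ∑ i, satVec app σ i (x, 1) = 0 := by
    simp [funext_iff, Finset.sum_apply, Fin.forall_fin_two]
  rw [hfun]
  refine forall_congr' fun x => ?_
  obtain ⟨h2, h3⟩ := happ x
  have hne : (app x).Nonempty := Finset.card_pos.1 (by omega)
  have ha := Finset.min'_mem _ hne
  have hne2 : ((app x).erase ((app x).min' hne)).Nonempty := by
    rw [← Finset.card_pos, Finset.card_erase_of_mem ha]
    omega
  rw [satVec_sum_fst app σ x hne hne2]
  constructor
  · rintro ⟨hfst, hsnd⟩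
    have hmin : ∀ i ∈ app x, σ i x = σ ((app x).min' hne) x := by
      intro i hi
      rcases eq_min_or_eq_second_or_eq_max h3 hne hne2 hi with h | h | ⟨hc, h⟩
      · rw [h]
      · rw [h, hfst]
      · rw [h, (satVec_sum_snd app σ x hne hc).1 hsnd]
    intro i hi j hj
    rw [hmin i hi, hmin j hj]
  · intro h
    refine ⟨h _ ha _ (Finset.mem_of_mem_erase (Finset.min'_mem _ hne2)), ?_⟩
    by_cases hc : (app x).card = 3
    · exact (satVec_sum_snd app σ x hne hc).2 (h _ ha _ (Finset.max'_mem _ hne))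
    · exact satVec_sum_snd_of_card_ne app σ x hc
end

section
/- Let D be a type, s : D → ZMod 5, and u, v : D → ZMod 5 functions with u ≠ v such that for every c ∈ D, u(c) ∈ {0, s(c)} and v(c) ∈ {0, s(c)}. Then for every a ∈ ZMod 5 with a ≠ 0, u ≠ a • v. -/
theorem stmt_16 {D : Type*} (s u v : D → ZMod 5) (huv : u ≠ v)
    (hu : ∀ c : D, u c ∈ ({0, s c} : Set (ZMod 5)))
    (hv : ∀ c : D, v c ∈ ({0, s c} : Set (ZMod 5))) :
    ∀ a : ZMod 5, a ≠ 0 → u ≠ a • v := by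
  have : Fact (Nat.Prime 5) := ⟨by norm_num⟩
  rintro a ha rfl
  refine huv (funext fun c => ?_)
  have hzero : (a • v) c = 0 ↔ v c = 0 := by simp [ha]
  rcases hu c with h | h
  · rw [h, hzero.mp h]
  · rcases hv c with h' | h'
    · rw [h', hzero.mpr h']
    · exact h.trans h'.symm
end

section
/- Let D be a type, s : D → ZMod 5, and u, v, w : D → ZMod 5 pairwise distinct functions such that for every c ∈ D, u(c) ∈ {0, s(c)}, v(c) ∈ {0, s(c)}, and w(c) ∈ {0, s(c)}. Then for every a ∈ ZMod 5 with a ≠ 0, u − w ≠ a • (w − v). -/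
theorem stmt_17 {D : Type*} (s u v w : D → ZMod 5)
    (huv : u ≠ v) (huw : u ≠ w) (hvw : v ≠ w)
    (hu : ∀ c : D, u c ∈ ({0, s c} : Set (ZMod 5)))
    (hv : ∀ c : D, v c ∈ ({0, s c} : Set (ZMod 5)))
    (hw : ∀ c : D, w c ∈ ({0, s c} : Set (ZMod 5))) :
    ∀ a : ZMod 5, a ≠ 0 → u - w ≠ a • (w - v) := by
  intro a _ h
  have : Fact (Nat.Prime 5) := ⟨by norm_num⟩
  have hcoord (c : D) : u c - w c = a * (w c - v c) := congrFun h c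
  obtain ⟨c, hc⟩ := Function.ne_iff.mp huw
  have hwv : w c ≠ v c := fun e => hc (sub_eq_zero.mp (by rw [hcoord, e, sub_self, mul_zero]))
  have huvc : u c = v c := by
    rcases hu c with h1 | h1 <;> rcases hv c with h2 | h2 <;> rcases hw c with h3 | h3 <;>
      simp_all
  have ha : a = -1 := by
    refine mul_right_cancel₀ (sub_ne_zero.mpr hwv) ?_
    rw [← hcoord, huvc]
    ring
  refine huv (funext fun d => ?_)
  have hd := hcoord d
  rw [ha] at hd
  linear_combination hd
end
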